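/- arXiv:1802.01210 — 3 statements merged into one kernel-verified Lean document; each statement's English description precedes it below -/
import Mathlib

section
/- Let X be a hypersurface of degree d and dimension n in P^{n+1} over F_q with Thas invariant k_X satisfying 1 ≤ k_X ≤ n. Then N_q(X) ≤ (d−1)·q^{k_X}·N_q(P^{n−k_X}) + N_q(P^{k_X}). -/
/-- `NP q N` is the number of `F_q`-points of `P^N`, i.e. `q^N + q^(N-1) + … + q + 1`. -/
def NP (q N : ℕ) : ℕ := ∑ i ∈ Finset.range (N + 1), q ^ i

/-- `Theta q d n k` is the quantity `Θ_{n,k}^{d,q} = (d-1)·q^k·N_q(P^{n-k}) + N_q(P^k)`. -/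
def Theta (q d n k : ℕ) : ℕ := (d - 1) * q ^ k * NP q (n - k) + NP q k

/-- The number of `F`-rational points of the hypersurface `f = 0` in `P^{m-1}`. -/
noncomputable def numPoints {F : Type*} [Field F] {m : ℕ}
    (f : MvPolynomial (Fin m) F) : ℕ :=
  Nat.card {p : Projectivization F (Fin m → F) // MvPolynomial.eval p.rep f = 0}

/-- The projective linear subspace `P(W)` is contained in the hypersurface `f = 0`. -/
def SubInX {F : Type*} [Field F] {m : ℕ}
    (f : MvPolynomial (Fin m) F) (W : Submodule F (Fin m → F)) : Prop :=
  ∀ v ∈ W, MvPolynomial.eval v f = 0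

/-- The Thas invariant of the hypersurface `f = 0` equals `k`: there is an `F`-linear
projective subspace of dimension `k` contained in it, and none of dimension `k + 1`. -/
def ThasEq {F : Type*} [Field F] {m : ℕ}
    (f : MvPolynomial (Fin m) F) (k : ℕ) : Prop :=
  (∃ W : Submodule F (Fin m → F), Module.finrank F W = k + 1 ∧ SubInX f W) ∧
  ¬ ∃ W : Submodule F (Fin m → F), Module.finrank F W = k + 2 ∧ SubInX f W

/-- `v` is a homogeneous coordinate vector of a singular `F`-point of `f = 0`. -/
def IsSingPt {F : Type*} [Field F] {m : ℕ}
    (f : MvPolynomial (Fin m) F) (v : Fin m → F) : Prop :=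
  v ≠ 0 ∧ MvPolynomial.eval v f = 0 ∧
    ∀ i, MvPolynomial.eval v (MvPolynomial.pderiv i f) = 0
open MvPolynomial in
/-- A homogeneous polynomial of degree `d ≤ #F` vanishing on the hyperplane `x₀ = 0` has at most
`(d - 1) * #F ^ k` zeros on the affine chart `x₀ = 1` of dimension `k + 1`, unless it vanishes
identically there. -/
theorem MvPolynomial.IsHomogeneous.card_affine_zeros_le {F : Type*} [Field F] [Fintype F]
    [DecidableEq F] {k d : ℕ} {H : MvPolynomial (Fin (k + 1 + 1)) F} (hH : H.IsHomogeneous d)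
    (hdq : d ≤ Fintype.card F) (h0 : ∀ y : Fin (k + 1) → F, eval (Fin.cons 0 y) H = 0)
    (h1 : ∃ y : Fin (k + 1) → F, eval (Fin.cons 1 y) H ≠ 0) :
    (Finset.univ.filter fun y : Fin (k + 1) → F => eval (Fin.cons 1 y) H = 0).card ≤
      (d - 1) * Fintype.card F ^ k := by
  set P := finSuccEquiv F (k + 1) H with hP
  set g := P.eval 1 with hg
  have hgev (y : Fin (k + 1) → F) : eval y g = eval (Fin.cons 1 y) H := by
    rw [eval_eq_eval_mv_eval', Polynomial.eval_map, hg, ← Polynomial.eval₂_hom]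
    simp [hP]
  have hc0 : P.coeff 0 = 0 := by
    refine (hH.finSuccEquiv_coeff_isHomogeneous 0 d (zero_add d)).eq_zero_of_forall_eval_eq_zero_of_le_card
      (fun y => ?_) (by simpa using hdq)
    have h := h0 y
    rw [eval_eq_eval_mv_eval', ← Polynomial.coeff_zero_eq_eval_zero, Polynomial.coeff_map] at h
    exact h
  have hdeg : g.totalDegree ≤ d - 1 := by
    rw [hg, Polynomial.eval_eq_sum, Polynomial.sum]
    refine totalDegree_finsetSum_le fun i hi => ?_
    have hid : i ≤ d := by
      refine (Polynomial.le_natDegree_of_mem_supp i hi).trans ?_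
      rw [hP, natDegree_finSuccEquiv]
      exact (degreeOf_le_totalDegree H 0).trans hH.totalDegree_le
    have hi0 : i ≠ 0 := by
      rintro rfl
      exact Polynomial.mem_support_iff.mp hi hc0
    rw [one_pow, mul_one]
    refine (hH.finSuccEquiv_coeff_isHomogeneous i (d - i) (by lia)).totalDegree_le.trans ?_
    lia
  have hg0 : g ≠ 0 := by
    obtain ⟨y, hy⟩ := h1
    rintro h
    exact hy (by rw [← hgev, h, map_zero])
  have hsz := schwartz_zippel_totalDegree hg0 (Finset.univ : Finset F)
  have hq : (0 : ℚ≥0) < Fintype.card F := by exact_mod_cast Fintype.card_pos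
  rw [Fintype.piFinset_univ, Finset.card_univ, div_le_div_iff₀ (by positivity) hq, pow_succ,
    ← mul_assoc, mul_le_mul_iff_left₀ hq] at hsz
  simp_rw [hgev] at hsz
  have hsz' : (Finset.univ.filter fun y : Fin (k + 1) → F => eval (Fin.cons 1 y) H = 0).card ≤
      g.totalDegree * Fintype.card F ^ k := by exact_mod_cast hsz
  exact hsz'.trans (Nat.mul_le_mul_right _ hdeg)

open MvPolynomial in
/-- Substituting a linear parametrization into a homogeneous polynomial. -/
theorem MvPolynomial.IsHomogeneous.exists_linear_substitution {F : Type*} [Field F] {m r d : ℕ}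
    {f : MvPolynomial (Fin m) F} (hf : f.IsHomogeneous d) (b : Fin r → Fin m → F) :
    ∃ H : MvPolynomial (Fin r) F, H.IsHomogeneous d ∧
      ∀ y : Fin r → F, eval y H = eval (∑ j, y j • b j) f := by
  refine ⟨MvPolynomial.aeval (fun i => ∑ j, C (b j i) * X j) f, ?_, fun y => ?_⟩
  · rw [← one_mul d]
    exact hf.aeval _ fun i => IsHomogeneous.sum _ _ _ fun j _ => by
      simpa using (isHomogeneous_C (Fin r) (b j i)).mul (isHomogeneous_X F j)
  · rw [aeval_def, algebraMap_eq, eval_eval₂, ← eval₂_id]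
    congr 1
    · ext; simp
    · ext i
      simp [Finset.sum_apply, mul_comm]

open MvPolynomial in
theorem MvPolynomial.IsHomogeneous.eval_smul_eq {F : Type*} [Field F] {m d : ℕ}
    {f : MvPolynomial (Fin m) F} (hf : f.IsHomogeneous d) (c : F) (v : Fin m → F) :
    eval (c • v) f = c ^ d * eval v f := by
  rw [eval_eq', eval_eq', Finset.mul_sum]
  refine Finset.sum_congr rfl fun e he => ?_
  have hdeg : ∑ i, e i = d := by
    rw [← Finsupp.degree_eq_sum]
    exact (DFunLike.congr_fun Finsupp.degree_eq_weight_one e).trans (hf (mem_support_iff.mp he))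
  simp_rw [Pi.smul_apply, smul_eq_mul, mul_pow]
  rw [Finset.prod_mul_distrib, Finset.prod_pow_eq_pow_sum, hdeg]
  ring

open MvPolynomial in
/-- Let `W` be a maximal linear space in the hypersurface `f = 0`. Outside `W`, the hypersurface
meets each coset of `W` in at most `(d - 1) * #F ^ k` points. -/
theorem card_zeros_coset_le {F : Type*} [Field F] [Fintype F] [DecidableEq F] {m k d : ℕ}
    {f : MvPolynomial (Fin m) F} (hf : f.IsHomogeneous d) (hdq : d ≤ Fintype.card F)
    {W : Submodule F (Fin m → F)} (hW : Module.finrank F W = k + 1) (hWf : SubInX f W)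
    (hmax : ¬ ∃ W : Submodule F (Fin m → F), Module.finrank F W = k + 2 ∧ SubInX f W)
    {v : Fin m → F} (hv : v ∉ W) [DecidablePred (· ∈ W)] :
    (Finset.univ.filter fun u : Fin m → F => eval u f = 0 ∧ u - v ∈ W).card ≤
      (d - 1) * Fintype.card F ^ k := by
  let b : Module.Basis (Fin (k + 1)) F W := Module.finBasisOfFinrankEq F W hW
  obtain ⟨H, hH, hHev⟩ := hf.exists_linear_substitution
    (Fin.cons v fun j => (b j : Fin m → F) : Fin (k + 1 + 1) → Fin m → F)
  have hcons (t : F) (y : Fin (k + 1) → F) :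
      eval (Fin.cons t y) H = eval (t • v + ((∑ j, y j • b j : W) : Fin m → F)) f := by
    rw [hHev, Fin.sum_univ_succ]
    simp
  have hpar {w : Fin m → F} (hw : w ∈ W) :
      ((∑ j, b.equivFun ⟨w, hw⟩ j • b j : W) : Fin m → F) = w := by
    rw [b.sum_equivFun]
  have h1 : ∃ y : Fin (k + 1) → F, eval (Fin.cons 1 y) H ≠ 0 := by
    by_contra! hall
    refine hmax ⟨W ⊔ F ∙ v, ?_, fun u hu => ?_⟩
    · rw [Submodule.finrank_sup_span_singleton hv, hW]
    · obtain ⟨w, hw, z, hz, rfl⟩ := Submodule.mem_sup.mp hu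
      obtain ⟨a, rfl⟩ := Submodule.mem_span_singleton.mp hz
      rcases eq_or_ne a 0 with rfl | ha
      · simpa using hWf w hw
      · have h := hall (b.equivFun ⟨a⁻¹ • w, W.smul_mem _ hw⟩)
        rw [hcons, hpar, one_smul] at h
        have h2 : w + a • v = a • (v + a⁻¹ • w) := by
          rw [smul_add, smul_inv_smul₀ ha, add_comm]
        rw [h2, hf.eval_smul_eq, h, mul_zero]
  refine le_trans ?_ (hH.card_affine_zeros_le hdq (fun y => ?_) h1)
  · refine Finset.card_le_card_of_surjOn
      (fun y => v + ((∑ j, y j • b j : W) : Fin m → F)) fun u hu => ?_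
    simp only [Finset.coe_filter, Finset.mem_univ, true_and, Set.mem_ofPred_eq] at hu
    refine ⟨b.equivFun ⟨u - v, hu.2⟩, ?_, ?_⟩
    · simp only [Finset.coe_filter, Finset.mem_univ, true_and, Set.mem_ofPred_eq]
      rw [hcons, hpar, one_smul, add_sub_cancel, hu.1]
    · simp only
      rw [hpar, add_sub_cancel]
  · rw [hcons, zero_smul, zero_add]
    exact hWf _ (Submodule.coe_mem _)

open MvPolynomial in
/-- Bound for the affine cone over the hypersurface `f = 0`. -/
theorem card_zeros_le_of_maximal {F : Type*} [Field F] [Fintype F] [DecidableEq F] {m k d : ℕ}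
    {f : MvPolynomial (Fin m) F} (hf : f.IsHomogeneous d) (hkm : k + 1 ≤ m)
    {W : Submodule F (Fin m → F)} (hW : Module.finrank F W = k + 1) (hWf : SubInX f W)
    (hmax : ¬ ∃ W : Submodule F (Fin m → F), Module.finrank F W = k + 2 ∧ SubInX f W) :
    (Finset.univ.filter fun u : Fin m → F => eval u f = 0).card ≤
      (d - 1) * Fintype.card F ^ k * (Fintype.card F ^ (m - (k + 1)) - 1) +
        Fintype.card F ^ (k + 1) := by
  classical
  set q := Fintype.card F with hq
  have hqpos : 0 < q := Fintype.card_pos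
  have hsplit : q ^ (k + 1) * q ^ (m - (k + 1)) = q ^ m := by
    rw [← pow_add, Nat.add_sub_cancel' hkm]
  by_cases hdq : d ≤ q
  · rw [← Finset.card_filter_add_card_filter_not (fun u => u ∉ W)]
    refine Nat.add_le_add ?_ ?_
    · have hQ : Fintype.card ((Fin m → F) ⧸ W) = q ^ (m - (k + 1)) := by
        rw [Module.card_eq_pow_finrank (K := F), Submodule.finrank_quotient, hW]
        simp [hq]
      have hcard : (Finset.univ.erase (0 : (Fin m → F) ⧸ W)).card = q ^ (m - (k + 1)) - 1 := by
        rw [Finset.card_erase_of_mem (Finset.mem_univ _), Finset.card_univ, hQ]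
      rw [← hcard]
      refine Finset.card_le_mul_card_image_of_maps_to (f := W.mkQ) (fun u hu => ?_) _
        fun x hx => ?_
      · simpa using (Finset.mem_filter.mp hu).2
      · obtain ⟨v, rfl⟩ := W.mkQ_surjective x
        have hv : v ∉ W := by simpa using hx
        refine le_trans (Finset.card_le_card fun u hu => ?_)
          (card_zeros_coset_le hf hdq hW hWf hmax hv)
        obtain ⟨hu, hux⟩ := Finset.mem_filter.mp hu
        exact Finset.mem_filter.mpr ⟨Finset.mem_univ _,
          (Finset.mem_filter.mp (Finset.mem_filter.mp hu).1).2, (Submodule.Quotient.eq W).mp hux⟩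
    · rw [hq, ← hW, ← Module.card_eq_pow_finrank, Fintype.card_subtype]
      refine Finset.card_le_card fun u hu => ?_
      simpa using (Finset.mem_filter.mp hu).2
  · calc (Finset.univ.filter fun u : Fin m → F => eval u f = 0).card
        ≤ q ^ m := by
          refine (Finset.card_le_univ _).trans_eq ?_
          simp [hq]
      _ = q * q ^ k * (q ^ (m - (k + 1)) - 1) + q ^ (k + 1) := by
          have h1 : 1 ≤ q ^ (m - (k + 1)) := Nat.one_le_pow _ _ hqpos
          rw [← pow_succ', ← hsplit, ← Nat.mul_succ, Nat.succ_eq_add_one, Nat.sub_add_cancel h1]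
      _ ≤ _ := by gcongr; lia

open MvPolynomial in
/-- Each projective point of `f = 0` is represented by `#F - 1` nonzero vectors. -/
theorem numPoints_mul_add_one_le {F : Type*} [Field F] [Fintype F] [DecidableEq F] {m d : ℕ}
    {f : MvPolynomial (Fin m) F} (hf : f.IsHomogeneous d) (hd : d ≠ 0) :
    numPoints f * (Fintype.card F - 1) + 1 ≤
      (Finset.univ.filter fun u : Fin m → F => eval u f = 0).card := by
  classical
  have h0 : (0 : Fin m → F) ∈ Finset.univ.filter fun u : Fin m → F => eval u f = 0 := by
    simpa [hd] using hf.eval_smul_eq 0 0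
  rw [← Finset.card_erase_add_one h0]
  refine Nat.add_le_add_right ?_ 1
  rw [numPoints, ← Fintype.card_units, ← Nat.card_eq_fintype_card, ← Nat.card_prod,
    ← Nat.card_eq_finsetCard]
  refine Nat.card_le_card_of_injective
    (fun x => ⟨x.2 • x.1.1.rep, Finset.mem_erase.mpr
      ⟨(smul_ne_zero_iff_ne x.2).mpr x.1.1.rep_nonzero, Finset.mem_filter.mpr
        ⟨Finset.mem_univ _, by
          rw [Units.smul_def, hf.eval_smul_eq, x.1.2, mul_zero]⟩⟩⟩) ?_
  rintro ⟨⟨p, hp⟩, a⟩ ⟨⟨p', hp'⟩, a'⟩ h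
  have h : a • p.rep = a' • p'.rep := congrArg Subtype.val h
  obtain rfl : p = p' := by
    rw [← p.mk_rep, ← p'.mk_rep, Projectivization.mk_eq_mk_iff]
    exact ⟨a⁻¹ * a', by rw [mul_smul, ← h, inv_smul_smul]⟩
  obtain rfl : a = a' := Units.ext (smul_left_injective F p.rep_nonzero h)
  rfl

theorem stmt0 {F : Type*} [Field F] [Fintype F] {n d k : ℕ}
    (hn : 1 ≤ n) (hd : 2 ≤ d) (hk1 : 1 ≤ k) (hkn : k ≤ n)
    (f : MvPolynomial (Fin (n + 2)) F) (hf0 : f ≠ 0) (hsq : Squarefree f)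
    (hhom : f.IsHomogeneous d) (hthas : ThasEq f k) :
    numPoints f ≤
      (d - 1) * Fintype.card F ^ k * NP (Fintype.card F) (n - k) + NP (Fintype.card F) k := by
  classical
  obtain ⟨⟨W, hW, hWf⟩, hmax⟩ := hthas
  have hle := (numPoints_mul_add_one_le hhom (by lia)).trans
    (card_zeros_le_of_maximal hhom (by lia) hW hWf hmax)
  have hq : 1 < Fintype.card F := Fintype.one_lt_card
  generalize Fintype.card F = q at *
  obtain ⟨x, rfl⟩ : ∃ x, q = x + 1 := ⟨q - 1, by lia⟩
  have hNP (N : ℕ) : NP (x + 1) N * x + 1 = (x + 1) ^ (N + 1) := geom_sum_mul_add x (N + 1)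
  rw [show n + 2 - (k + 1) = n - k + 1 by lia, ← hNP, ← hNP, Nat.add_sub_cancel,
    Nat.add_sub_cancel] at hle
  refine Nat.le_of_mul_le_mul_right (c := x) ?_ (by lia)
  rw [add_mul, mul_assoc _ (NP _ _)]
  lia
end

section
/- Let X be a hypersurface of degree d and dimension n in P^{n+1} over F_q with 0 < k_X ≤ n, and suppose N_q(X) = Θ_{n,k_X}^{d,q}. Then for every F_q-point p of X there exists an F_q-linear subspace of P^{n+1} of dimension k_X which is contained in X and contains p. -/
namespace MvPolynomial

variable {F : Type*} [Field F] {σ : Type*}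

/-- The restriction of `g` to the parametrized line `t ↦ x + t • u`. -/
noncomputable def restrictLine (g : MvPolynomial σ F) (x u : σ → F) : Polynomial F :=
  aeval (fun i => Polynomial.C (u i) * Polynomial.X + Polynomial.C (x i)) g

theorem eval_restrictLine (g : MvPolynomial σ F) (x u : σ → F) (t : F) :
    (g.restrictLine x u).eval t = eval (x + t • u) g := by
  induction g using MvPolynomial.induction_on with
  | C a => simp [restrictLine]
  | add p q hp hq => simp_all [restrictLine]
  | mul_X p i hp =>
    simp only [restrictLine, map_mul, aeval_X, Polynomial.eval_mul] at *
    rw [hp]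
    simp
    ring_nf
    simp

theorem derivative_restrictLine_eval_zero [Fintype σ] (g : MvPolynomial σ F) (x u : σ → F) :
    (g.restrictLine x u).derivative.eval 0 = ∑ i, eval x (pderiv i g) * u i := by
  classical
  induction g using MvPolynomial.induction_on with
  | C a => simp [restrictLine]
  | add p q hp hq => simp_all [restrictLine, add_mul, Finset.sum_add_distrib]
  | mul_X p i hp =>
    have h := eval_restrictLine p x u 0
    simp only [restrictLine, map_mul, aeval_X, Polynomial.derivative_mul,
      Polynomial.eval_add, Polynomial.eval_mul] at *
    rw [hp, h]
    have hX : ∀ j, eval x (pderiv j (X i : MvPolynomial σ F)) = if i = j then 1 else 0 := by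
      intro j
      rw [pderiv_X, Pi.single_apply]
      split_ifs <;> simp
    simp only [Derivation.leibniz, smul_eq_mul, map_add, map_mul, hX, eval_X, add_mul,
      Finset.sum_add_distrib, mul_ite, mul_one, mul_zero, ite_mul, zero_mul, zero_smul, add_zero,
      Finset.sum_ite_eq, Finset.mem_univ, if_true, Finset.sum_mul, Polynomial.derivative_C,
      Polynomial.derivative_X, Polynomial.eval_C, Polynomial.eval_X, Polynomial.derivative_C_mul,
      zero_add]
    rw [add_comm]
    exact congrArg₂ _ rfl (Finset.sum_congr rfl fun j _ => by ring)

theorem restrictLine_ne_zero_of_derivative (g : MvPolynomial σ F) (x u : σ → F)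
    (h : (g.restrictLine x u).derivative.eval 0 ≠ 0) : g.restrictLine x u ≠ 0 := by
  rintro h0
  simp [h0] at h

theorem natDegree_restrictLine_le (g : MvPolynomial σ F) {r : ℕ} (hg : g.totalDegree ≤ r)
    (x u : σ → F) : (g.restrictLine x u).natDegree ≤ r := by
  simpa [restrictLine] using aeval_natDegree_le g hg
    (fun i => Polynomial.C (u i) * Polynomial.X + Polynomial.C (x i)) (n := 1)
    (fun i => Polynomial.natDegree_linear_le)

theorem coeff_restrictLine (g : MvPolynomial σ F) {r : ℕ} (hg : g.totalDegree ≤ r)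
    (x u : σ → F) :
    (g.restrictLine x u).coeff r = eval u (homogeneousComponent r g) := by
  classical
  have key : ∀ s : σ →₀ ℕ, s.degree ≤ r → ∀ a : F,
      ((monomial s a).restrictLine x u).coeff r =
        eval u (homogeneousComponent r (monomial s a)) := by
    intro s hs a
    have hlin : ∀ i : σ,
        (Polynomial.C (u i) * Polynomial.X + Polynomial.C (x i)).natDegree ≤ 1 :=
      fun i => Polynomial.natDegree_linear_le
    rcases hs.lt_or_eq with hlt | rfl
    · rw [homogeneousComponent_eq_zero _ _ ((totalDegree_monomial_le s a).trans_lt hlt), map_zero]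
      exact Polynomial.coeff_eq_zero_of_natDegree_lt
        ((natDegree_restrictLine_le _ (totalDegree_monomial_le s a) x u).trans_lt hlt)
    · rw [homogeneousComponent_eq_self (isHomogeneous_monomial a rfl), eval_monomial,
        restrictLine, aeval_monomial, Polynomial.algebraMap_eq, Polynomial.coeff_C_mul]
      congr 1
      simp only [Finsupp.prod, Finsupp.degree]
      have : ∀ T : Finset σ,
          (∏ i ∈ T, (Polynomial.C (u i) * Polynomial.X + Polynomial.C (x i)) ^ s i).natDegree ≤
            ∑ i ∈ T, s i ∧
          (∏ i ∈ T, (Polynomial.C (u i) * Polynomial.X + Polynomial.C (x i)) ^ s i).coeff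
            (∑ i ∈ T, s i) = ∏ i ∈ T, u i ^ s i := by
        intro T
        induction T using Finset.induction_on with
        | empty => simp
        | insert j T hj ih =>
          have hd : ((Polynomial.C (u j) * Polynomial.X + Polynomial.C (x j)) ^ s j).natDegree
              ≤ s j := by
            simpa using Polynomial.natDegree_pow_le_of_le (s j) (hlin j)
          have hc : ((Polynomial.C (u j) * Polynomial.X + Polynomial.C (x j)) ^ s j).coeff (s j)
              = u j ^ s j := by
            simpa using Polynomial.coeff_pow_of_natDegree_le (m := s j) (hlin j)
          rw [Finset.prod_insert hj, Finset.sum_insert hj, Finset.prod_insert hj]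
          refine ⟨Polynomial.natDegree_mul_le_of_le hd ih.1, ?_⟩
          rw [Polynomial.coeff_mul_add_eq_of_natDegree_le hd ih.1, hc, ih.2]
      exact (this s.support).2
  have hsum : ∀ T : Finset (σ →₀ ℕ), (∀ s ∈ T, s.degree ≤ r) →
      ((∑ s ∈ T, monomial s (coeff s g)).restrictLine x u).coeff r =
        eval u (homogeneousComponent r (∑ s ∈ T, monomial s (coeff s g))) := by
    intro T hT
    have : (∑ s ∈ T, monomial s (coeff s g)).restrictLine x u =
        ∑ s ∈ T, (monomial s (coeff s g)).restrictLine x u := map_sum _ _ _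
    rw [this, map_sum, map_sum, Polynomial.finsetSum_coeff]
    exact Finset.sum_congr rfl fun s hs => key s (hT s hs) _
  have := hsum g.support fun s hs => (le_totalDegree hs).trans hg
  rwa [← as_sum g] at this

theorem totalDegree_lt_of_homogeneousComponent_eq_zero (g : MvPolynomial σ F) {r : ℕ}
    (hr : 0 < r) (hg : g.totalDegree ≤ r) (h : homogeneousComponent r g = 0) :
    g.totalDegree < r := by
  rw [totalDegree, Finset.sup_lt_iff (by simpa using hr)]
  intro s hs
  change s.degree < r
  have hle : s.degree ≤ r := (le_totalDegree hs).trans hg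
  refine lt_of_le_of_ne hle fun he => ?_
  have := congrArg (coeff s) h
  rw [coeff_homogeneousComponent, if_pos he, coeff_zero] at this
  exact mem_support_iff.1 hs this

variable [Fintype F] [DecidableEq F]

theorem card_zeros_mul_card_le {m : ℕ} {g : MvPolynomial (Fin m) F} (hg : g ≠ 0) :
    (Finset.univ.filter fun y : Fin m → F => eval y g = 0).card * Fintype.card F ≤
      g.totalDegree * Fintype.card F ^ m := by
  have h := schwartz_zippel_totalDegree hg (Finset.univ : Finset F)
  rw [Fintype.piFinset_univ, Finset.card_univ] at h
  have hq : (0 : ℚ≥0) < Fintype.card F := by exact_mod_cast Fintype.card_pos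
  rw [div_le_div_iff₀ (by positivity) hq] at h
  exact_mod_cast h

theorem card_zeros_line_le (g : MvPolynomial σ F) (x u : σ → F) (h : g.restrictLine x u ≠ 0) :
    (Finset.univ.filter fun t : F => eval (x + t • u) g = 0).card ≤
      (g.restrictLine x u).natDegree := by
  refine Polynomial.card_le_degree_of_subset_roots (Z := Finset.univ.filter _) fun t ht => ?_
  rw [Polynomial.mem_roots h, Polynomial.IsRoot, eval_restrictLine]
  simpa using ht

theorem derivative_restrictLine_ne_zero_of_card_eq (g : MvPolynomial σ F) (x u : σ → F)
    (h : g.restrictLine x u ≠ 0) (hx : eval x g = 0)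
    (hc : (Finset.univ.filter fun t : F => eval (x + t • u) g = 0).card =
      (g.restrictLine x u).natDegree) :
    (g.restrictLine x u).derivative.eval 0 ≠ 0 := by
  intro hder
  have hroot : (g.restrictLine x u).IsRoot 0 := by
    rw [Polynomial.IsRoot, eval_restrictLine]; simpa using hx
  have hlt := (Polynomial.one_lt_rootMultiplicity_iff_isRoot h).2 ⟨hroot, hder⟩
  have hsub : (Finset.univ.filter fun t : F => eval (x + t • u) g = 0).val ≤
      (g.restrictLine x u).roots := by
    rw [Finset.val_le_iff_val_subset]
    intro t ht
    rw [Polynomial.mem_roots h, Polynomial.IsRoot, eval_restrictLine]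
    simpa using ht
  have heq := Multiset.eq_of_le_of_card_le hsub (by
    rw [Finset.card_val, hc]; exact Polynomial.card_roots' _)
  have hnd := (Finset.univ.filter fun t : F => eval (x + t • u) g = 0).nodup
  rw [heq, Multiset.nodup_iff_count_le_one] at hnd
  have := hnd 0
  rw [Polynomial.count_roots] at this
  omega

end MvPolynomial

theorem sum_card_filter_add {V T : Type*} [Fintype V] [AddCommGroup V] [Fintype T]
    (φ : T → V) (Z : V → Prop) [DecidablePred Z] :
    ∑ x : V, (Finset.univ.filter fun t : T => Z (x + φ t)).card =
      Fintype.card T * (Finset.univ.filter Z).card := by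
  simp only [Finset.card_filter]
  rw [Finset.sum_comm, ← Finset.card_univ, ← smul_eq_mul, ← Finset.sum_const]
  exact Finset.sum_congr rfl fun t _ =>
    Equiv.sum_comp (Equiv.addRight (φ t)) fun x => if Z x then 1 else 0

namespace MvPolynomial

variable {F : Type*} [Field F] [Fintype F] [DecidableEq F]

/-- If the zeros of a polynomial of degree at most `r < q` attain the Schwartz–Zippel bound,
some direction meets the zero set in exactly `r` points on each parallel line. -/
theorem exists_direction_of_card_zeros_eq {m r : ℕ} {g : MvPolynomial (Fin m) F} (hr : 0 < r)
    (hrq : r < Fintype.card F) (hdeg : g.totalDegree ≤ r) (hg : g ≠ 0)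
    (hcard : (Finset.univ.filter fun y : Fin m → F => eval y g = 0).card * Fintype.card F =
      r * Fintype.card F ^ m) :
    ∃ u : Fin m → F, (∀ x, (g.restrictLine x u) ≠ 0) ∧
      ∀ x, (Finset.univ.filter fun t : F => eval (x + t • u) g = 0).card = r := by
  have hq : 0 < Fintype.card F := Fintype.card_pos
  have htop : homogeneousComponent r g ≠ 0 := by
    intro h
    have hlt := totalDegree_lt_of_homogeneousComponent_eq_zero g hr hdeg h
    have hle := card_zeros_mul_card_le hg
    rw [hcard] at hle
    exact absurd (Nat.le_of_mul_le_mul_right hle (by positivity)) (by omega)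
  obtain ⟨u, hu⟩ : ∃ u, eval u (homogeneousComponent r g) ≠ 0 := by
    by_contra! h
    refine htop ((homogeneousComponent_isHomogeneous r g).eq_zero_of_forall_eval_eq_zero_of_le_card
      h ?_)
    rw [Cardinal.mk_fintype]
    exact_mod_cast hrq.le
  have hne : ∀ x, g.restrictLine x u ≠ 0 := by
    intro x h
    rw [← coeff_restrictLine g hdeg x u, h] at hu
    simp at hu
  have hle : ∀ x, (Finset.univ.filter fun t : F => eval (x + t • u) g = 0).card ≤ r :=
    fun x => (card_zeros_line_le g x u (hne x)).trans (natDegree_restrictLine_le g hdeg x u)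
  refine ⟨u, hne, fun x => ?_⟩
  have hsum := sum_card_filter_add (fun t : F => t • u) (fun y => eval y g = 0)
  have hconst : ∑ _x : Fin m → F, r = Fintype.card F *
      (Finset.univ.filter fun y : Fin m → F => eval y g = 0).card := by
    rw [Finset.sum_const, Finset.card_univ, Fintype.card_pi_const, smul_eq_mul, mul_comm, ← hcard,
      mul_comm]
  exact (Finset.sum_eq_sum_iff_of_le fun x _ => hle x).1 (hsum.trans hconst.symm) x
    (Finset.mem_univ x)

/-- If the zeros of a polynomial of degree at most `r < q` attain the Schwartz–Zippel bound,
every zero lies on an affine hyperplane consisting of zeros. -/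
theorem exists_dual_of_card_zeros_eq {m r : ℕ} {g : MvPolynomial (Fin m) F} (hr : 0 < r)
    (hrq : r < Fintype.card F) (hdeg : g.totalDegree ≤ r) (hg : g ≠ 0)
    (hcard : (Finset.univ.filter fun y : Fin m → F => eval y g = 0).card * Fintype.card F =
      r * Fintype.card F ^ m) {p : Fin m → F} (hp : eval p g = 0) :
    ∃ ℓ : Module.Dual F (Fin m → F), ℓ ≠ 0 ∧ ∀ w, ℓ w = 0 → eval (p + w) g = 0 := by
  obtain ⟨u, hne, hline⟩ := exists_direction_of_card_zeros_eq hr hrq hdeg hg hcard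
  let ℓ : Module.Dual F (Fin m → F) := ∑ i, eval p (pderiv i g) • LinearMap.proj i
  have hℓ : ∀ w, ℓ w = (g.restrictLine p w).derivative.eval 0 := by
    intro w
    rw [derivative_restrictLine_eval_zero]
    simp [ℓ]
  have hℓu : ℓ u ≠ 0 := by
    rw [hℓ]
    refine derivative_restrictLine_ne_zero_of_card_eq g p u (hne p) hp (le_antisymm
      (card_zeros_line_le g p u (hne p)) ?_)
    rw [hline]
    exact natDegree_restrictLine_le g hdeg p u
  refine ⟨ℓ, fun h => hℓu (by simp [h]), fun w hw => ?_⟩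
  by_contra hpw
  have hw0 : (Finset.univ.filter fun t : F => eval (p + t • w) g = 0).card ≤ r := by
    refine (card_zeros_line_le g p w fun h => hpw ?_).trans
      (natDegree_restrictLine_le g hdeg p w)
    have := eval_restrictLine g p w 1
    rw [h, one_smul] at this
    simpa using this.symm
  have hother : ∀ a : F, ((Finset.univ.erase (0 : F)).filter fun s : F =>
      eval (p + s • (u + a • w)) g = 0).card ≤ r - 1 := by
    intro a
    have h0 : g.restrictLine p (u + a • w) ≠ 0 := by
      apply restrictLine_ne_zero_of_derivative
      rw [← hℓ]
      simpa [hw] using hℓu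
    have hle := (card_zeros_line_le g p (u + a • w) h0).trans
      (natDegree_restrictLine_le g hdeg p (u + a • w))
    rw [Finset.filter_erase, Finset.card_erase_of_mem (by simpa using hp)]
    omega
  let D : F → F → ℕ := fun s t => if eval (p + t • w + s • u) g = 0 then 1 else 0
  have hcount : ∑ s, ∑ t, D s t = Fintype.card F * r := by
    rw [Finset.sum_comm, ← Finset.card_univ, ← smul_eq_mul, ← Finset.sum_const]
    refine Finset.sum_congr rfl fun t _ => ?_
    rw [← hline (p + t • w), Finset.card_filter]
  have hzero : ∑ t, D 0 t ≤ r := by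
    rw [Finset.card_filter] at hw0
    simpa [D] using hw0
  have hnonzero : ∑ s ∈ Finset.univ.erase 0, ∑ t, D s t ≤ Fintype.card F * (r - 1) := by
    have hscale : ∀ s ∈ Finset.univ.erase (0 : F), ∑ t, D s t =
        ∑ a : F, if eval (p + s • (u + a • w)) g = 0 then 1 else 0 := by
      intro s hs
      rw [← Equiv.sum_comp (Equiv.mulLeft₀ s (Finset.ne_of_mem_erase hs)) (D s)]
      refine Finset.sum_congr rfl fun a _ => ?_
      have : p + (s * a) • w + s • u = p + s • (u + a • w) := by
        rw [smul_add, smul_smul]; abel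
      simp [D, this]
    rw [Finset.sum_congr rfl hscale, Finset.sum_comm, ← Finset.card_univ, ← smul_eq_mul,
      ← Finset.sum_const]
    refine Finset.sum_le_sum fun a _ => ?_
    rw [← Finset.card_filter]
    exact hother a
  rw [← Finset.add_sum_erase _ _ (Finset.mem_univ (0 : F))] at hcount
  obtain ⟨r, rfl⟩ := Nat.exists_eq_add_of_lt hr
  simp only [zero_add, Nat.add_sub_cancel] at *
  nlinarith

end MvPolynomial

namespace MvPolynomial

theorem IsHomogeneous.eval_smul {R σ : Type*} [CommSemiring R] {f : MvPolynomial σ R} {d : ℕ}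
    (hf : f.IsHomogeneous d) (a : R) (v : σ → R) : eval (a • v) f = a ^ d * eval v f := by
  rw [eval_eq, eval_eq, Finset.mul_sum]
  refine Finset.sum_congr rfl fun s hs => ?_
  rw [hf.degree_eq_sum_deg_support hs]
  simp only [Pi.smul_apply, smul_eq_mul, mul_pow, Finset.prod_mul_distrib, Finset.prod_pow_eq_pow_sum]
  ring

theorem totalDegree_aeval_le {R σ τ : Type*} [CommSemiring R] (f : MvPolynomial σ R)
    (l : σ → MvPolynomial τ R) (hl : ∀ i, (l i).totalDegree ≤ 1) :
    (aeval l f).totalDegree ≤ f.totalDegree := by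
  rw [aeval_def, eval₂_eq]
  refine totalDegree_finsetSum_le fun s hs => ?_
  refine (totalDegree_mul _ _).trans ?_
  rw [algebraMap_eq, totalDegree_C, zero_add]
  refine (totalDegree_finsetProd _ _).trans (le_trans ?_ (le_totalDegree hs))
  refine Finset.sum_le_sum fun i _ => (totalDegree_pow _ _).trans ?_
  simpa using Nat.mul_le_mul_left (s i) (hl i)

variable {F : Type*} [Field F] [Fintype F] {σ : Type*}

/-- On a translate of a linear subspace on which a form of degree `d ≤ q` vanishes, the form is
given by a polynomial of degree less than `d`. -/
theorem exists_polynomial_on_translate {d m : ℕ} (hd : 0 < d)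
    (hdq : d ≤ Fintype.card F) {f : MvPolynomial σ F} (hf : f.IsHomogeneous d)
    (e : (Fin m → F) →ₗ[F] (σ → F)) (he : ∀ y, eval (e y) f = 0) (v : σ → F) :
    ∃ g : MvPolynomial (Fin m) F, g.totalDegree < d ∧ ∀ y, eval y g = eval (v + e y) f := by
  let l : σ → MvPolynomial (Fin m) F := fun j =>
    C (v j) + ∑ i, C (e (Pi.single i 1) j) * X i
  have hcoord : ∀ y j, e y j = ∑ i, e (Pi.single i 1) j * y i := by
    intro y j
    conv_lhs => rw [pi_eq_sum_univ' y]
    simp [Finset.sum_apply, mul_comm]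
  have hl : ∀ j, (l j).totalDegree ≤ 1 := by
    intro j
    refine (totalDegree_add _ _).trans (max_le (by simp) ?_)
    refine totalDegree_finsetSum_le fun i _ => (totalDegree_mul _ _).trans ?_
    simp
  have hdeg : (aeval l f).totalDegree ≤ d := (totalDegree_aeval_le f l hl).trans hf.totalDegree_le
  have hline : ∀ y, (aeval l f).restrictLine 0 y = f.restrictLine v (e y) := by
    intro y
    have : (aeval fun i => Polynomial.C (y i) * Polynomial.X + Polynomial.C ((0 : Fin m → F) i)).comp
        (aeval l) = (aeval fun j => Polynomial.C (e y j) * Polynomial.X + Polynomial.C (v j) :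
          MvPolynomial σ F →ₐ[F] Polynomial F) := by
      ext1 j
      simp [l, hcoord y j, Finset.sum_mul, add_comm, mul_assoc]
    exact DFunLike.congr_fun this f
  refine ⟨aeval l f, totalDegree_lt_of_homogeneousComponent_eq_zero _ hd hdeg ?_, fun y => ?_⟩
  · refine (homogeneousComponent_isHomogeneous d _).eq_zero_of_forall_eval_eq_zero_of_le_card
      (fun y => ?_) ?_
    · rw [← coeff_restrictLine _ hdeg 0 y, hline, coeff_restrictLine f hf.totalDegree_le,
        homogeneousComponent_eq_self hf, he]
    · rw [Cardinal.mk_fintype]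
      exact_mod_cast hdq
  · have h1 := eval_restrictLine (aeval l f) 0 y 1
    rw [hline, eval_restrictLine] at h1
    simpa using h1.symm

end MvPolynomial

open MvPolynomial

section Slice

variable {F : Type*} [Field F] [Fintype F] [DecidableEq F] {N d k : ℕ}
  {f : MvPolynomial (Fin N) F} {L : Submodule F (Fin N → F)}

theorem card_zeros_translate [Fintype L] (e : (Fin (k + 1) → F) ≃ₗ[F] L) {v : Fin N → F}
    {g : MvPolynomial (Fin (k + 1)) F} (hg : ∀ y, eval y g = eval (v + (e y : Fin N → F)) f) :
    (Finset.univ.filter fun x : L => eval (v + (x : Fin N → F)) f = 0).card =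
      (Finset.univ.filter fun y : Fin (k + 1) → F => eval y g = 0).card := by
  refine (Finset.card_equiv e.toEquiv fun y => ?_).symm
  simp [hg]

theorem card_zeros_translate_le [Fintype L] (hd : 0 < d) (hf : f.IsHomogeneous d)
    (hL : Module.finrank F L = k + 1) (hLf : ∀ w ∈ L, eval w f = 0) {v : Fin N → F}
    (hv : ∃ x ∈ L, eval (v + x) f ≠ 0) :
    (Finset.univ.filter fun x : L => eval (v + (x : Fin N → F)) f = 0).card ≤
      (d - 1) * Fintype.card F ^ k := by
  obtain ⟨x, hxL, hx⟩ := hv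
  by_cases hdq : d ≤ Fintype.card F
  · let e : (Fin (k + 1) → F) ≃ₗ[F] L := (Module.finBasisOfFinrankEq F L hL).equivFun.symm
    obtain ⟨g, hgd, hg⟩ := exists_polynomial_on_translate hd hdq hf (L.subtype ∘ₗ e.toLinearMap)
      (fun y => hLf _ (e y).2) v
    rw [card_zeros_translate e hg]
    have hg0 : g ≠ 0 := by
      rintro rfl
      have := hg (e.symm ⟨x, hxL⟩)
      simp at this
      exact hx this.symm
    have hle := card_zeros_mul_card_le hg0
    have hq : 0 < Fintype.card F := Fintype.card_pos
    refine Nat.le_of_mul_le_mul_right (hle.trans ?_) hq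
    rw [pow_succ, ← mul_assoc]
    gcongr
    omega
  · refine (Finset.card_le_univ _).trans ?_
    rw [Module.card_eq_pow_finrank (K := F) (V := L), hL, pow_succ, mul_comm]
    gcongr
    omega

theorem exists_submodule_of_card_zeros_translate_eq [Fintype L] (hd : 2 ≤ d)
    (hf : f.IsHomogeneous d)
    (hL : Module.finrank F L = k + 1) (hLf : ∀ w ∈ L, eval w f = 0) {v : Fin N → F}
    (hv : ∃ x ∈ L, eval (v + x) f ≠ 0) (hvf : eval v f = 0)
    (hcard : (Finset.univ.filter fun x : L => eval (v + (x : Fin N → F)) f = 0).card =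
      (d - 1) * Fintype.card F ^ k) :
    ∃ K ≤ L, Module.finrank F K = k ∧ ∀ w ∈ K, eval (v + w) f = 0 := by
  obtain ⟨x, hxL, hx⟩ := hv
  have hdq : d - 1 < Fintype.card F := by
    have hlt : (Finset.univ.filter fun x : L => eval (v + (x : Fin N → F)) f = 0).card < Fintype.card L :=
      Finset.card_lt_univ_of_notMem (x := ⟨x, hxL⟩) (by simpa using hx)
    rw [Module.card_eq_pow_finrank (K := F) (V := L), hL, pow_succ', hcard] at hlt
    exact lt_of_mul_lt_mul_right hlt (Nat.zero_le _)
  let e : (Fin (k + 1) → F) ≃ₗ[F] L := (Module.finBasisOfFinrankEq F L hL).equivFun.symm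
  obtain ⟨g, hgd, hg⟩ := exists_polynomial_on_translate (by omega) (by omega) hf
    (L.subtype ∘ₗ e.toLinearMap) (fun y => hLf _ (e y).2) v
  have hg0 : g ≠ 0 := by
    rintro rfl
    have := hg (e.symm ⟨x, hxL⟩)
    simp at this
    exact hx this.symm
  rw [card_zeros_translate e hg] at hcard
  obtain ⟨ℓ, hℓ, hker⟩ := exists_dual_of_card_zeros_eq (r := d - 1) (by omega) hdq (by omega) hg0
    (by rw [hcard, pow_succ, mul_assoc]) (p := 0) (by rw [hg]; simpa using hvf)
  refine ⟨(LinearMap.ker ℓ).map (L.subtype ∘ₗ e.toLinearMap), ?_, ?_, ?_⟩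
  · rintro _ ⟨y, -, rfl⟩
    exact (e y).2
  · have hinj : Function.Injective (L.subtype ∘ₗ e.toLinearMap) :=
      L.injective_subtype.comp e.injective
    rw [← (Submodule.equivMapOfInjective _ hinj (LinearMap.ker ℓ)).finrank_eq]
    have := Module.Dual.finrank_ker_add_one_of_ne_zero hℓ
    rw [Module.finrank_fin_fun] at this
    omega
  · rintro _ ⟨y, hy, rfl⟩
    rw [← hg]
    simpa using hker y hy

end Slice

section Counting

variable {F : Type*} [Field F] {m : ℕ}

theorem NP_mul_pred_add_one (q N : ℕ) (hq : 0 < q) : NP q N * (q - 1) + 1 = q ^ (N + 1) := by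
  obtain ⟨x, rfl⟩ := Nat.exists_eq_add_of_lt hq
  simpa [NP] using geom_sum_mul_add x (N + 1)

theorem subInX_sup_span_singleton {f : MvPolynomial (Fin m) F} {d : ℕ} (hf : f.IsHomogeneous d)
    {K : Submodule F (Fin m → F)} (hK : SubInX f K) {v : Fin m → F}
    (hv : ∀ w ∈ K, eval (v + w) f = 0) : SubInX f (K ⊔ Submodule.span F {v}) := by
  intro y hy
  obtain ⟨w, hw, z, hz, rfl⟩ := Submodule.mem_sup.1 hy
  obtain ⟨a, rfl⟩ := Submodule.mem_span_singleton.1 hz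
  rcases eq_or_ne a 0 with rfl | ha
  · simpa using hK w hw
  · have : w + a • v = a • (v + a⁻¹ • w) := by
      rw [smul_add, smul_smul, mul_inv_cancel₀ ha, one_smul, add_comm]
    rw [this, hf.eval_smul, hv _ (K.smul_mem _ hw), mul_zero]

variable [Fintype F] [DecidableEq F]

theorem card_nonzero_zeros {f : MvPolynomial (Fin m) F} {d : ℕ} (hf : f.IsHomogeneous d) :
    (Finset.univ.filter fun v : Fin m → F => v ≠ 0 ∧ eval v f = 0).card =
      numPoints f * (Fintype.card F - 1) := by
  have hsmul : ∀ (a : Fˣ) (v : Fin m → F), eval (a • v) f = 0 ↔ eval v f = 0 := by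
    intro a v
    rw [Units.smul_def, hf.eval_smul]
    simp
  let φ : {p : Projectivization F (Fin m → F) // eval p.rep f = 0} × Fˣ →
      {v : Fin m → F // v ≠ 0 ∧ eval v f = 0} := fun p =>
    ⟨p.2 • p.1.1.rep, (smul_ne_zero_iff_ne p.2).2 p.1.1.rep_nonzero, (hsmul _ _).2 p.1.2⟩
  have hφ : Function.Bijective φ := by
    constructor
    · rintro ⟨⟨p, hp⟩, a⟩ ⟨⟨p', hp'⟩, b⟩ h
      have h : a • p.rep = b • p'.rep := congrArg Subtype.val h
      have hpp : p = p' := by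
        rw [← p.mk_rep, ← p'.mk_rep, Projectivization.mk_eq_mk_iff]
        exact ⟨a⁻¹ * b, by rw [mul_smul, ← h, inv_smul_smul]⟩
      subst hpp
      have : (a : F) = b := smul_left_injective F p.rep_nonzero h
      simp [Units.ext this]
    · rintro ⟨v, hv, hvf⟩
      obtain ⟨a, ha⟩ := Projectivization.exists_smul_eq_mk_rep F v hv
      refine ⟨⟨⟨Projectivization.mk F v hv, ?_⟩, a⁻¹⟩, Subtype.ext ?_⟩
      · rw [← ha, hsmul, hvf]
      · simp [φ, ← ha]
  have := Nat.card_congr (Equiv.ofBijective φ hφ)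
  rw [Nat.card_prod, Nat.card_eq_fintype_card (α := Fˣ), Fintype.card_units,
    Nat.card_eq_fintype_card (α := {v : Fin m → F // v ≠ 0 ∧ eval v f = 0}),
    Fintype.card_subtype] at this
  exact this.symm

theorem card_zeros_notMem {n d k : ℕ} {f : MvPolynomial (Fin (n + 2)) F} (hf : f.IsHomogeneous d)
    (hnum : numPoints f = Theta (Fintype.card F) d n k)
    {L : Submodule F (Fin (n + 2) → F)} [DecidablePred (· ∈ L)]
    (hL : Module.finrank F L = k + 1) (hLf : SubInX f L) :
    (Finset.univ.filter fun v => v ∉ L ∧ eval v f = 0).card =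
      (d - 1) * Fintype.card F ^ k * (Fintype.card F ^ (n - k + 1) - 1) := by
  have hq : 0 < Fintype.card F := Fintype.card_pos
  have hcardL : (Finset.univ.filter fun v => v ∈ L ∧ v ≠ 0).card + 1 =
      Fintype.card F ^ (k + 1) := by
    rw [← hL, ← Module.card_eq_pow_finrank (K := F) (V := L), Fintype.card_subtype,
      ← Finset.filter_filter, Finset.filter_ne', Finset.card_erase_add_one (by simp)]
  have hsplit : (Finset.univ.filter fun v => v ≠ 0 ∧ eval v f = 0).card =
      (Finset.univ.filter fun v => v ∈ L ∧ v ≠ 0).card +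
        (Finset.univ.filter fun v => v ∉ L ∧ eval v f = 0).card := by
    rw [← Finset.card_union_of_disjoint]
    · congr 1
      ext v
      have h0 : v ∉ L → v ≠ 0 := fun h h' => h (h' ▸ L.zero_mem)
      have h1 : v ∈ L → eval v f = 0 := hLf v
      simp only [Finset.mem_filter, Finset.mem_union, Finset.mem_univ, true_and]
      tauto
    · rw [Finset.disjoint_filter]
      tauto
  rw [card_nonzero_zeros hf, hnum, Theta, add_mul] at hsplit
  have h1 := NP_mul_pred_add_one (Fintype.card F) k hq
  have h2 := NP_mul_pred_add_one (Fintype.card F) (n - k) hq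
  rw [← h2, Nat.add_sub_cancel, ← mul_assoc]
  omega

/-- If the point count attains the Thas bound, every translate of `L` other than `L` itself
contains the maximal possible number of zeros. -/
theorem card_zeros_translate_eq {n d k : ℕ} (hd : 2 ≤ d) (hkn : k ≤ n)
    {f : MvPolynomial (Fin (n + 2)) F} (hf : f.IsHomogeneous d)
    (hnum : numPoints f = Theta (Fintype.card F) d n k)
    {L : Submodule F (Fin (n + 2) → F)} [Fintype L]
    (hL : Module.finrank F L = k + 1) (hLf : SubInX f L)
    (hmax : ∀ v ∉ L, ∃ x ∈ L, eval (v + x) f ≠ 0) {v : Fin (n + 2) → F} (hv : v ∉ L) :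
    (Finset.univ.filter fun x : L => eval (v + (x : Fin (n + 2) → F)) f = 0).card =
      (d - 1) * Fintype.card F ^ k := by
  classical
  have hcard : Fintype.card L = Fintype.card F ^ (k + 1) := by
    rw [← hL, ← Module.card_eq_pow_finrank (K := F) (V := L)]
  let c : (Fin (n + 2) → F) → ℕ := fun v =>
    (Finset.univ.filter fun x : L => v + (x : Fin (n + 2) → F) ∉ L ∧
      eval (v + (x : Fin (n + 2) → F)) f = 0).card
  have hc : ∀ v ∉ L, c v =
      (Finset.univ.filter fun x : L => eval (v + (x : Fin (n + 2) → F)) f = 0).card := by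
    intro v hv
    simp [c, L.add_mem_iff_left, hv]
  have hle : ∀ v ∈ Finset.univ, c v ≤ if v ∉ L then (d - 1) * Fintype.card F ^ k else 0 := by
    intro v _
    by_cases h : v ∈ L
    · simp [c, L.add_mem_iff_left, h]
    · rw [hc v h, if_pos h]
      exact card_zeros_translate_le (by omega) hf hL hLf (hmax v h)
  have hcompl : (Finset.univ.filter fun v => v ∉ L).card =
      Fintype.card F ^ (k + 1) * (Fintype.card F ^ (n - k + 1) - 1) := by
    have h := Finset.card_filter_add_card_filter_not (s := Finset.univ) (· ∈ L)
    rw [← Fintype.card_subtype, Finset.card_univ, Fintype.card_pi_const] at h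
    have hLc : Fintype.card {x // x ∈ L} = Fintype.card F ^ (k + 1) := by
      rw [← hcard]
    rw [Nat.mul_sub, ← pow_add, mul_one, show k + 1 + (n - k + 1) = n + 2 by omega]
    omega
  have hsum : ∑ v, c v = ∑ v, if v ∉ L then (d - 1) * Fintype.card F ^ k else 0 := by
    rw [sum_card_filter_add (fun x : L => (x : Fin (n + 2) → F))
      (fun v => v ∉ L ∧ eval v f = 0), card_zeros_notMem hf hnum hL hLf, hcard,
      ← Finset.sum_filter, Finset.sum_const, hcompl, smul_eq_mul]
    ring
  rw [← hc v hv, (Finset.sum_eq_sum_iff_of_le hle).1 hsum v (Finset.mem_univ v), if_pos hv]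

end Counting

theorem stmt5 {F : Type*} [Field F] [Fintype F] {n d k : ℕ}
    (hn : 1 ≤ n) (hd : 2 ≤ d) (hk1 : 0 < k) (hkn : k ≤ n)
    (f : MvPolynomial (Fin (n + 2)) F) (hf0 : f ≠ 0) (hsq : Squarefree f)
    (hhom : f.IsHomogeneous d) (hthas : ThasEq f k)
    (heq : numPoints f = Theta (Fintype.card F) d n k) :
    ∀ v : Fin (n + 2) → F, v ≠ 0 → MvPolynomial.eval v f = 0 →
      ∃ W : Submodule F (Fin (n + 2) → F),
        Module.finrank F W = k + 1 ∧ SubInX f W ∧ v ∈ W := by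
  classical
  intro v hv0 hvf
  obtain ⟨⟨L, hL, hLf⟩, hnot⟩ := hthas
  by_cases hvL : v ∈ L
  · exact ⟨L, hL, hLf, hvL⟩
  have hmax : ∀ v ∉ L, ∃ x ∈ L, eval (v + x) f ≠ 0 := by
    intro v hv
    by_contra! h
    refine hnot ⟨L ⊔ Submodule.span F {v}, ?_, subInX_sup_span_singleton hhom hLf h⟩
    rw [Submodule.finrank_sup_span_singleton hv, hL]
  obtain ⟨K, hKL, hK, hKf⟩ := exists_submodule_of_card_zeros_translate_eq hd hhom hL hLf
    (hmax v hvL) hvf (card_zeros_translate_eq hd hkn hhom heq hL hLf hmax hvL)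
  refine ⟨K ⊔ Submodule.span F {v}, ?_,
    subInX_sup_span_singleton hhom (fun w hw => hLf w (hKL hw)) hKf,
    Submodule.mem_sup_right (Submodule.mem_span_singleton_self v)⟩
  rw [Submodule.finrank_sup_span_singleton (fun h => hvL (hKL h)), hK]
end

section
/- Let q = s^2 be a square prime power and let X be a hypersurface of degree d = s+1 and dimension n in P^{n+1} over F_q with 0 < k_X ≤ n, and suppose N_q(X) = Θ_{n,k_X}^{d,q}. If p is a singular F_q-point of X, with homogeneous coordinate vector v ∈ F_q^{n+2}, then X is a cone with vertex p; that is, f(x + t·v) = f(x) holds as an identity of polynomials in x = (X_0,…,X_{n+1}) and t (equivalently, after an F_q-linear change of coordinates sending p to (0:…:0:1), the polynomial f does not involve the last variable). -/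
noncomputable section

open Polynomial in
/-- The restriction of `f` to the parametrized line `t ↦ x + t • u`. -/
def lineRestr {F : Type*} [Field F] {m : ℕ} (f : MvPolynomial (Fin m) F) (x u : Fin m → F) :
    F[X] :=
  MvPolynomial.aeval (fun i => C (x i) + C (u i) * X) f

/-- The derivative of `f` at `x` in the direction `u`. -/
def dirDeriv {F : Type*} [Field F] {m : ℕ} (f : MvPolynomial (Fin m) F) (x u : Fin m → F) : F :=
  ∑ i, u i * MvPolynomial.eval x (MvPolynomial.pderiv i f)

open Classical in
/-- The indicator function of the zero set of `f`. -/
def zeroInd {F : Type*} [Field F] {m : ℕ} (f : MvPolynomial (Fin m) F) (x : Fin m → F) : ℕ :=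
  if MvPolynomial.eval x f = 0 then 1 else 0

end

section Line
open Polynomial

variable {F : Type*} [Field F] {m : ℕ} {f : MvPolynomial (Fin m) F}

theorem dirDeriv_add (x u v : Fin m → F) :
    dirDeriv f x (u + v) = dirDeriv f x u + dirDeriv f x v := by
  simp [dirDeriv, add_mul, Finset.sum_add_distrib]

theorem dirDeriv_smul (x u : Fin m → F) (c : F) :
    dirDeriv f x (c • u) = c * dirDeriv f x u := by
  simp [dirDeriv, Finset.mul_sum, mul_assoc]

theorem eval_lineRestr (x u : Fin m → F) (t : F) :
    (lineRestr f x u).eval t = MvPolynomial.eval (x + t • u) f := by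
  induction f using MvPolynomial.induction_on with
  | C a => simp [lineRestr]
  | add p q hp hq => simp only [lineRestr, map_add, eval_add] at *; rw [hp, hq]
  | mul_X p j hp =>
    simp only [lineRestr, map_mul, eval_mul] at *
    rw [hp]
    simp [mul_comm t]

theorem coeff_zero_lineRestr (x u : Fin m → F) :
    (lineRestr f x u).coeff 0 = MvPolynomial.eval x f := by
  rw [coeff_zero_eq_eval_zero, eval_lineRestr, zero_smul, add_zero]

theorem coeff_one_lineRestr (x u : Fin m → F) :
    (lineRestr f x u).coeff 1 = dirDeriv f x u := by
  induction f using MvPolynomial.induction_on with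
  | C a => simp [lineRestr, dirDeriv]
  | add p q hp hq =>
    simp only [dirDeriv, lineRestr, map_add, coeff_add, mul_add, Finset.sum_add_distrib] at *
    rw [hp, hq]
  | mul_X p j hp =>
    have h0 := coeff_zero_lineRestr (f := p) x u
    simp only [lineRestr, dirDeriv] at *
    simp only [map_mul, MvPolynomial.aeval_X, Derivation.leibniz, MvPolynomial.pderiv_X]
    rw [mul_add, coeff_add, coeff_mul_C, ← mul_assoc, coeff_mul_X, coeff_mul_C, hp, h0]
    simp only [smul_eq_mul, map_add, map_mul, MvPolynomial.eval_X, mul_add,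
      Finset.sum_add_distrib, Pi.single_apply, Finset.sum_mul]
    rw [add_comm]
    congr 1
    · simp [apply_ite, mul_comm]
    · exact Finset.sum_congr rfl fun i _ => by ring

theorem natDegree_prod_linear_le (x u : Fin m → F) (s : Finset (Fin m)) (c : Fin m → ℕ) :
    (∏ i ∈ s, (C (x i) + C (u i) * X) ^ c i).natDegree ≤ ∑ i ∈ s, c i := by
  refine (natDegree_prod_le _ _).trans (Finset.sum_le_sum fun i _ => ?_)
  refine natDegree_pow_le.trans ?_
  have : (C (x i) + C (u i) * X).natDegree ≤ 1 := by
    rw [add_comm]; exact natDegree_linear_le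
  simpa using Nat.mul_le_mul_left (c i) this

theorem lineRestr_eq_sum (x u : Fin m → F) :
    lineRestr f x u = ∑ c ∈ f.support, C (f.coeff c) *
      ∏ i, (C (x i) + C (u i) * X) ^ c i := by
  rw [lineRestr, MvPolynomial.aeval_def, MvPolynomial.eval₂_eq']
  rfl

theorem natDegree_lineRestr_le {d : ℕ} (hf : f.totalDegree ≤ d) (x u : Fin m → F) :
    (lineRestr f x u).natDegree ≤ d := by
  rw [lineRestr_eq_sum]
  refine natDegree_sum_le_of_forall_le _ _ fun c hc => ?_
  refine (natDegree_C_mul_le _ _).trans ((natDegree_prod_linear_le x u _ _).trans ?_)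
  refine le_trans (le_of_eq ?_) ((MvPolynomial.le_totalDegree hc).trans hf)
  rw [Finsupp.sum_fintype _ _ fun _ => rfl]

theorem reflect_pow_linear (a b : F) (n : ℕ) :
    reflect n ((C a + C b * X) ^ n) = (C b + C a * X) ^ n := by
  induction n with
  | zero => simp [reflect_one]
  | succ n ih =>
    have h1 : (C a + C b * X).natDegree ≤ 1 := by
      rw [add_comm]; exact natDegree_linear_le
    rw [pow_succ, reflect_mul _ _ (by simpa using natDegree_pow_le_of_le n h1) h1, ih, pow_succ,
      reflect_add, reflect_C, reflect_C_mul, reflect_one_X]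
    ring

theorem reflect_prod_linear (x u : Fin m → F) (s : Finset (Fin m)) (c : Fin m → ℕ) :
    reflect (∑ i ∈ s, c i) (∏ i ∈ s, (C (x i) + C (u i) * X) ^ c i) =
      ∏ i ∈ s, (C (u i) + C (x i) * X) ^ c i := by
  classical
  induction s using Finset.induction_on with
  | empty => simp [reflect_one]
  | insert j s hj ih =>
    have h1 : (C (x j) + C (u j) * X).natDegree ≤ 1 := by
      rw [add_comm]; exact natDegree_linear_le
    rw [Finset.sum_insert hj, Finset.prod_insert hj, Finset.prod_insert hj,
      reflect_mul _ _ (by simpa using natDegree_pow_le_of_le (c j) h1)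
        (natDegree_prod_linear_le x u s c), ih, reflect_pow_linear]

theorem sum_exponents_eq {d : ℕ} (hf : f.IsHomogeneous d) {c : Fin m →₀ ℕ}
    (hc : c ∈ f.support) : ∑ i, c i = d := by
  have := hf (MvPolynomial.mem_support_iff.1 hc)
  rwa [Finsupp.weight_apply, Finsupp.sum_fintype _ _ (by simp), Finset.sum_congr rfl] at this
  simp

theorem coeff_lineRestr_swap {d j : ℕ} (hf : f.IsHomogeneous d) (hj : j ≤ d) (x u : Fin m → F) :
    (lineRestr f x u).coeff (d - j) = (lineRestr f u x).coeff j := by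
  simp only [lineRestr_eq_sum, finsetSum_coeff, coeff_C_mul]
  refine Finset.sum_congr rfl fun c hc => ?_
  have hd := sum_exponents_eq hf hc
  rw [← reflect_prod_linear x u Finset.univ c, coeff_reflect, hd, revAt_le hj]

theorem eval_smul_of_isHomogeneous {d : ℕ} (hf : f.IsHomogeneous d) (c : F) (x : Fin m → F) :
    MvPolynomial.eval (c • x) f = c ^ d * MvPolynomial.eval x f := by
  rw [MvPolynomial.eval_eq', MvPolynomial.eval_eq', Finset.mul_sum]
  refine Finset.sum_congr rfl fun e he => ?_
  have hd := sum_exponents_eq hf he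
  simp only [Pi.smul_apply, smul_eq_mul, mul_pow, Finset.prod_mul_distrib,
    Finset.prod_pow_eq_pow_sum, hd]
  ring

theorem coeff_lineRestr_deg {d : ℕ} (hf : f.IsHomogeneous d) (x u : Fin m → F) :
    (lineRestr f x u).coeff d = MvPolynomial.eval u f := by
  simpa [coeff_zero_lineRestr] using coeff_lineRestr_swap hf (Nat.zero_le d) x u

theorem coeff_lineRestr_pred {s : ℕ} (hf : f.IsHomogeneous (s + 1)) (x u : Fin m → F) :
    (lineRestr f x u).coeff s = dirDeriv f u x := by
  simpa [coeff_one_lineRestr] using coeff_lineRestr_swap hf (Nat.le_add_left 1 s) x u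
end Line

section Count
open Polynomial

variable {F : Type*} [Field F] {m : ℕ} {f : MvPolynomial (Fin m) F}

open Classical in
theorem zeroInd_line (x u : Fin m → F) (t : F) :
    zeroInd f (x + t • u) = if (lineRestr f x u).eval t = 0 then 1 else 0 := by
  rw [eval_lineRestr]; rfl

theorem zeroInd_of_eq {x : Fin m → F} (h : MvPolynomial.eval x f = 0) : zeroInd f x = 1 :=
  if_pos h

theorem zeroInd_of_ne {x : Fin m → F} (h : MvPolynomial.eval x f ≠ 0) : zeroInd f x = 0 :=
  if_neg h

variable [Fintype F]

open Classical in
theorem sum_ite_isRoot_le {P : F[X]} (hP : P ≠ 0) :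
    (∑ t : F, if P.eval t = 0 then 1 else 0) ≤ P.natDegree := by
  rw [← Finset.card_filter]
  refine le_trans ?_ P.card_roots'
  refine le_trans (Finset.card_le_card ?_) P.roots.toFinset_card_le
  intro t ht
  simpa [hP] using ht

theorem sum_zeroInd_line_le {x u : Fin m → F} (hP : lineRestr f x u ≠ 0) :
    ∑ t : F, zeroInd f (x + t • u) ≤ (lineRestr f x u).natDegree := by
  simpa only [zeroInd_line] using sum_ite_isRoot_le hP

theorem sum_zeroInd_line_lt {x u : Fin m → F} (hP : lineRestr f x u ≠ 0)
    (h0 : MvPolynomial.eval x f = 0) (h1 : dirDeriv f x u = 0) :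
    ∑ t : F, zeroInd f (x + t • u) < (lineRestr f x u).natDegree := by
  have hdvd : X ^ 2 ∣ lineRestr f x u := by
    rw [X_pow_dvd_iff]
    intro i hi
    interval_cases i
    · rw [coeff_zero_lineRestr, h0]
    · rw [coeff_one_lineRestr, h1]
  obtain ⟨Q, hQ⟩ := hdvd
  have hQ0 : Q ≠ 0 := by rintro rfl; exact hP (by rw [hQ, mul_zero])
  have hdeg : (lineRestr f x u).natDegree = Q.natDegree + 2 := by
    rw [hQ, natDegree_X_pow_mul _ hQ0]
  have h := sum_ite_isRoot_le (mul_ne_zero X_ne_zero hQ0)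
  rw [natDegree_X_mul hQ0] at h
  rw [hdeg]
  refine lt_of_le_of_lt ?_ (Nat.lt_succ_of_le h)
  refine le_of_eq (Finset.sum_congr rfl fun t _ => ?_)
  rw [zeroInd_line, hQ]
  congr 1
  simp

theorem sum_zeroInd_line_punctured_lt {x u : Fin m → F} (hP : lineRestr f x u ≠ 0)
    (h0 : MvPolynomial.eval x f = 0) [DecidableEq F] :
    ∑ t ∈ Finset.univ.erase (0 : F), zeroInd f (x + t • u) < (lineRestr f x u).natDegree := by
  have h := sum_zeroInd_line_le hP
  rw [← Finset.add_sum_erase _ _ (Finset.mem_univ (0 : F)), zero_smul, add_zero,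
    zeroInd_of_eq h0] at h
  omega

theorem sum_lines_eq {L : Submodule F (Fin m → F)} [Fintype L] (I : (Fin m → F) → ℕ)
    (x : Fin m → F) (u : L) :
    ∑ y : L, ∑ t : F, I (x + y + t • (u : Fin m → F)) =
      Fintype.card F * ∑ y : L, I (x + y) := by
  rw [Finset.sum_comm, ← smul_eq_mul, ← Finset.card_univ, ← Finset.sum_const]
  refine Finset.sum_congr rfl fun t _ => ?_
  rw [← Equiv.sum_comp (Equiv.addRight (t • u)) fun y : L => I (x + y)]
  simp [add_assoc]

theorem sum_pencil_eq [DecidableEq F] {L : Submodule F (Fin m → F)} [Fintype L]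
    (I : (Fin m → F) → ℕ) (x : Fin m → F) (z : L) :
    ∑ u : L, ∑ t ∈ Finset.univ.erase (0 : F), I (x + z + t • (u : Fin m → F)) =
      (Fintype.card F - 1) * ∑ y : L, I (x + y) := by
  rw [Finset.sum_comm, ← smul_eq_mul, ← Finset.card_univ,
    ← Finset.card_erase_of_mem (Finset.mem_univ (0 : F)), ← Finset.sum_const]
  refine Finset.sum_congr rfl fun t ht => ?_
  have ht0 : t ≠ 0 := Finset.ne_of_mem_erase ht
  rw [← ((MulAction.toPerm (Units.mk0 t ht0)).trans (Equiv.addLeft z) : L ≃ L).sum_comp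
    (fun y : L => I (x + y))]
  simp [add_assoc, Units.smul_def]

theorem sum_cosets_eq {L : Submodule F (Fin m → F)} [Fintype L] (I : (Fin m → F) → ℕ) :
    ∑ x : Fin m → F, ∑ y : L, I (x + y) = Fintype.card L * ∑ x : Fin m → F, I x := by
  rw [Finset.sum_comm, ← smul_eq_mul, ← Finset.card_univ, ← Finset.sum_const]
  refine Finset.sum_congr rfl fun y _ => ?_
  rw [← Equiv.sum_comp (Equiv.addRight (y : Fin m → F)) I]
  simp

end Count

section Subspace
open Polynomial

variable {F : Type*} [Field F] {m s : ℕ} {f : MvPolynomial (Fin m) F}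
  {L : Submodule F (Fin m → F)}

theorem natDegree_lineRestr_le_of_eval_eq_zero (hf : f.IsHomogeneous (s + 1)) {u : Fin m → F}
    (hu : MvPolynomial.eval u f = 0) (x : Fin m → F) : (lineRestr f x u).natDegree ≤ s :=
  natDegree_le_pred (natDegree_lineRestr_le hf.totalDegree_le x u)
    (by rw [coeff_lineRestr_deg hf, hu])

theorem natDegree_lineRestr_le_of_dirDeriv_eq_zero (hf : f.IsHomogeneous (s + 1))
    {u x : Fin m → F} (hu : MvPolynomial.eval u f = 0) (hd : dirDeriv f u x = 0) :
    (lineRestr f x u).natDegree ≤ s - 1 :=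
  natDegree_le_pred (natDegree_lineRestr_le_of_eval_eq_zero hf hu x)
    (by rw [coeff_lineRestr_pred hf, hd])

theorem lineRestr_ne_zero_of_dirDeriv (hf : f.IsHomogeneous (s + 1)) {u x : Fin m → F}
    (hd : dirDeriv f u x ≠ 0) : lineRestr f x u ≠ 0 := by
  intro h
  rw [← coeff_lineRestr_pred hf, h, coeff_zero] at hd
  exact hd rfl

theorem lineRestr_ne_zero_of_eval {u x : Fin m → F} {t : F}
    (h : MvPolynomial.eval (x + t • u) f ≠ 0) : lineRestr f x u ≠ 0 := by
  intro h'
  rw [← eval_lineRestr, h', eval_zero] at h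
  exact h rfl

variable [Fintype F]

theorem dirDeriv_eq_zero_of_subInX (hf : f.IsHomogeneous (s + 1)) (hs : s + 1 < Fintype.card F)
    (hL : SubInX f L) {u y : Fin m → F} (hu : u ∈ L) (hy : y ∈ L) : dirDeriv f u y = 0 := by
  have : lineRestr f u y = 0 := by
    refine eq_zero_of_natDegree_lt_card_of_eval_eq_zero _ Function.injective_id (fun t => ?_)
      ((natDegree_lineRestr_le hf.totalDegree_le u y).trans_lt hs)
    rw [eval_lineRestr]
    exact hL _ (L.add_mem hu (L.smul_mem _ hy))
  rw [← coeff_one_lineRestr, this, coeff_zero]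

theorem sum_zeroInd_line_le_of_dirDeriv_ne_zero (hf : f.IsHomogeneous (s + 1))
    {u x : Fin m → F} (hu : MvPolynomial.eval u f = 0) (hd : dirDeriv f u x ≠ 0) :
    ∑ t : F, zeroInd f (x + t • u) ≤ s :=
  (sum_zeroInd_line_le (lineRestr_ne_zero_of_dirDeriv hf hd)).trans
    (natDegree_lineRestr_le_of_eval_eq_zero hf hu x)

theorem dirDeriv_add_of_subInX (hf : f.IsHomogeneous (s + 1)) (hs : s + 1 < Fintype.card F)
    (hL : SubInX f L) {u y : Fin m → F} (hu : u ∈ L) (hy : y ∈ L) (x : Fin m → F) :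
    dirDeriv f u (x + y) = dirDeriv f u x := by
  rw [dirDeriv_add, dirDeriv_eq_zero_of_subInX hf hs hL hu hy, add_zero]

theorem card_mul_sum_coset_le [Fintype L] (hf : f.IsHomogeneous (s + 1))
    (hs : s + 1 < Fintype.card F) (hL : SubInX f L) {x u : Fin m → F} (hu : u ∈ L)
    (hd : dirDeriv f u x ≠ 0) :
    Fintype.card F * ∑ y : L, zeroInd f (x + y) ≤ Fintype.card L * s := by
  rw [← sum_lines_eq _ x ⟨u, hu⟩, ← smul_eq_mul, ← Finset.card_univ, ← Finset.sum_const]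
  refine Finset.sum_le_sum fun y _ =>
    sum_zeroInd_line_le_of_dirDeriv_ne_zero hf (hL u hu) ?_
  rwa [dirDeriv_add_of_subInX hf hs hL hu y.2]

theorem card_mul_sum_coset_lt [Fintype L] (hf : f.IsHomogeneous (s + 1)) (hs0 : 0 < s)
    (hs : s + 1 < Fintype.card F) (hL : SubInX f L) {x : Fin m → F}
    (hx : ∃ z ∈ L, MvPolynomial.eval (x + z) f ≠ 0) (hd : ∀ u ∈ L, dirDeriv f u x = 0) :
    Fintype.card F * ∑ y : L, zeroInd f (x + y) < Fintype.card L * s := by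
  classical
  obtain ⟨z, hz, hxz⟩ := hx
  have h : (Fintype.card F - 1) * ∑ y : L, zeroInd f (x + y) ≤ Fintype.card L * (s - 1) := by
    rw [← sum_pencil_eq _ x ⟨z, hz⟩, ← smul_eq_mul (Fintype.card L), ← Finset.card_univ,
      ← Finset.sum_const]
    refine Finset.sum_le_sum fun u _ => ?_
    refine (Finset.sum_le_sum_of_subset (Finset.erase_subset _ _)).trans ?_
    refine (sum_zeroInd_line_le (lineRestr_ne_zero_of_eval (t := 0) (by simpa using hxz))).trans
      (natDegree_lineRestr_le_of_dirDeriv_eq_zero hf (hL u u.2) ?_)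
    rw [dirDeriv_add_of_subInX hf hs hL u.2 hz, hd u u.2]
  have hpos : 0 < Fintype.card L := Fintype.card_pos
  generalize (∑ y : L, zeroInd f (x + y)) = N at *
  obtain ⟨q, hq⟩ : ∃ q, Fintype.card F = q + 1 := ⟨Fintype.card F - 1, by omega⟩
  obtain ⟨r, rfl⟩ : ∃ r, s = r + 1 := ⟨s - 1, by omega⟩
  rw [hq] at *
  simp only [Nat.add_sub_cancel] at h
  by_contra! hcon
  have h1 := Nat.mul_le_mul_left q hcon
  have h2 := Nat.mul_le_mul_left (q + 1) h
  have h3 : r + 1 < q := by omega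
  nlinarith [Nat.mul_lt_mul_of_pos_left h3 hpos]

/-- In the extremal case every coset of `L` outside `L` has the maximal number of zeros. -/
theorem exists_dirDeriv_ne_zero [Fintype L] (hf : f.IsHomogeneous (s + 1)) (hs0 : 0 < s)
    (hs : s + 1 < Fintype.card F) (hL : SubInX f L)
    (hmax : ∀ x ∉ L, ∃ z ∈ L, MvPolynomial.eval (x + z) f ≠ 0)
    (hZ : Fintype.card F * ∑ x, zeroInd f x + Fintype.card L * s =
      Fintype.card F * Fintype.card L + Fintype.card (Fin m → F) * s)
    {x : Fin m → F} (hx : x ∉ L) :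
    ∃ u ∈ L, dirDeriv f u x ≠ 0 ∧ ∀ y ∈ L, ∑ t : F, zeroInd f (x + y + t • u) = s := by
  classical
  have hle : ∀ w ∈ (Finset.univ : Finset (Fin m → F)),
      Fintype.card F * ∑ y : L, zeroInd f (w + y) ≤
        if w ∈ L then Fintype.card F * Fintype.card L else Fintype.card L * s := by
    intro w _
    split_ifs with hw
    · refine Nat.mul_le_mul_left _ ?_
      rw [← Finset.card_univ, Finset.card_eq_sum_ones]
      exact Finset.sum_le_sum fun y _ => by unfold zeroInd; split_ifs <;> simp
    · by_cases hd : ∀ u ∈ L, dirDeriv f u w = 0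
      · exact (card_mul_sum_coset_lt hf hs0 hs hL (hmax w hw) hd).le
      · push Not at hd
        obtain ⟨u, hu, hd⟩ := hd
        exact card_mul_sum_coset_le hf hs hL hu hd
  have hcard : (Finset.univ.filter fun w : Fin m → F => w ∈ L).card = Fintype.card L := by
    rw [← Fintype.card_subtype]
  have hsum : ∑ w : Fin m → F, Fintype.card F * ∑ y : L, zeroInd f (w + y) =
      ∑ w : Fin m → F,
        if w ∈ L then Fintype.card F * Fintype.card L else Fintype.card L * s := by
    rw [← Finset.mul_sum, sum_cosets_eq, Finset.sum_ite, Finset.sum_const, Finset.sum_const,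
      hcard, smul_eq_mul, smul_eq_mul]
    have h2 := Finset.card_filter_add_card_filter_not
      (s := (Finset.univ : Finset (Fin m → F))) (fun w => w ∈ L)
    rw [hcard, Finset.card_univ] at h2
    rw [← h2] at hZ
    generalize (Finset.univ.filter fun w : Fin m → F => w ∉ L).card = a at *
    have := congrArg (Fintype.card L * ·) hZ
    linarith
  have heq := (Finset.sum_eq_sum_iff_of_le hle).1 hsum x (Finset.mem_univ x)
  rw [if_neg hx] at heq
  have hex : ∃ u ∈ L, dirDeriv f u x ≠ 0 := by
    by_contra! hd
    exact (card_mul_sum_coset_lt hf hs0 hs hL (hmax x hx) hd).ne heq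
  obtain ⟨u, hu, hd⟩ := hex
  refine ⟨u, hu, hd, fun y hy => ?_⟩
  rw [← sum_lines_eq _ x ⟨u, hu⟩, ← smul_eq_mul, ← Finset.card_univ, ← Finset.sum_const] at heq
  refine (Finset.sum_eq_sum_iff_of_le fun y _ => ?_).1 heq ⟨y, hy⟩ (Finset.mem_univ _)
  refine sum_zeroInd_line_le_of_dirDeriv_ne_zero hf (hL u hu) ?_
  rwa [dirDeriv_add_of_subInX hf hs hL hu y.2]

/-- In the extremal case singular points lie on every maximal linear subspace. -/
theorem mem_of_isSingPt [Fintype L] (hf : f.IsHomogeneous (s + 1)) (hs0 : 0 < s)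
    (hs : s + 1 < Fintype.card F) (hL : SubInX f L)
    (hmax : ∀ x ∉ L, ∃ z ∈ L, MvPolynomial.eval (x + z) f ≠ 0)
    (hZ : Fintype.card F * ∑ x, zeroInd f x + Fintype.card L * s =
      Fintype.card F * Fintype.card L + Fintype.card (Fin m → F) * s)
    {v : Fin m → F} (hv : MvPolynomial.eval v f = 0) (hv' : ∀ u, dirDeriv f v u = 0) : v ∈ L := by
  by_contra hvL
  obtain ⟨u, hu, hd, hcount⟩ := exists_dirDeriv_ne_zero hf hs0 hs hL hmax hZ hvL
  have h := sum_zeroInd_line_lt (lineRestr_ne_zero_of_dirDeriv hf hd) hv (hv' u)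
  have h2 := natDegree_lineRestr_le_of_eval_eq_zero hf (hL u hu) v
  have h3 := hcount 0 L.zero_mem
  rw [add_zero] at h3
  omega

/-- A sum over an affine plane, split into the lines through the point `(a, b)`. -/
theorem sum_plane_eq_pencil [DecidableEq F] (I : F → F → ℕ) (a b : F) :
    ∑ x, ∑ y, I x y = ∑ y, I a y +
      ∑ c : F, ∑ t ∈ Finset.univ.erase (0 : F), I (a + t) (b + t * c) := by
  rw [← Equiv.sum_comp (Equiv.addLeft a), ← Finset.add_sum_erase _ _ (Finset.mem_univ (0 : F)),
    Finset.sum_comm (t := Finset.univ.erase (0 : F))]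
  simp only [Equiv.coe_addLeft, add_zero]
  congr 1
  refine Finset.sum_congr rfl fun t ht => ?_
  have ht0 : t ≠ 0 := Finset.ne_of_mem_erase ht
  rw [← Equiv.sum_comp ((Equiv.mulLeft₀ t ht0).trans (Equiv.addLeft b))]
  simp

section Plane

variable {x u v : Fin m → F}

/-- In an affine plane with exactly `s * q` zeros, a direction along which the degree drops
contains a line of zeros. -/
theorem exists_line_of_zeros (hf : f.IsHomogeneous (s + 1)) (hs0 : 0 < s)
    (hv : MvPolynomial.eval v f = 0) (hdv : ∀ y, dirDeriv f v y = 0)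
    (hcount : ∀ b : F, ∑ t : F, zeroInd f (x + b • v + t • u) = s) :
    ∃ a : F, lineRestr f (x + a • u) v = 0 := by
  by_contra! hne
  have h1 : ∑ b : F, ∑ t : F, zeroInd f (x + b • v + t • u) = Fintype.card F * s := by
    simp [hcount]
  have h2 : ∑ t : F, ∑ b : F, zeroInd f (x + b • v + t • u) ≤ Fintype.card F * (s - 1) := by
    rw [← smul_eq_mul, ← Finset.card_univ, ← Finset.sum_const]
    refine Finset.sum_le_sum fun t _ => ?_
    simp only [add_right_comm x _ (t • u)]
    exact (sum_zeroInd_line_le (hne t)).trans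
      (natDegree_lineRestr_le_of_dirDeriv_eq_zero hf hv (hdv _))
  rw [Finset.sum_comm, h1] at h2
  have := Nat.le_of_mul_le_mul_left h2 Fintype.card_pos
  omega

/-- A line of zeros in direction `v` forces every zero of the plane onto such a line. -/
theorem lineRestr_eq_zero_of_line_of_zeros (hf : f.IsHomogeneous (s + 1)) (hs0 : 0 < s)
    (hs : s + 1 < Fintype.card F)
    (hv : MvPolynomial.eval v f = 0) (hdv : ∀ y, dirDeriv f v y = 0)
    (huv : ∀ c : F, MvPolynomial.eval (u + c • v) f = 0)
    (hd : ∀ a b : F, dirDeriv f u (x + b • v + a • u) ≠ 0)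
    (hcount : ∀ b : F, ∑ t : F, zeroInd f (x + b • v + t • u) = s)
    {a₁ : F} (ha₁ : lineRestr f (x + a₁ • u) v = 0) {a b : F}
    (hab : MvPolynomial.eval (x + a • u + b • v) f = 0) :
    lineRestr f (x + a • u) v = 0 := by
  classical
  by_contra hne
  have hu : MvPolynomial.eval u f = 0 := by simpa using huv 0
  have haa : a₁ ≠ a := by rintro rfl; exact hne ha₁
  have hline : ∀ c : F, lineRestr f (x + a • u + b • v) (u + c • v) ≠ 0 := by
    intro c hc
    set e := x + a • u + b • v + (a₁ - a) • (u + c • v) with he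
    have he' : e = x + a₁ • u + (b + (a₁ - a) * c) • v := by
      rw [he]; module
    have h1 : ∀ t : F, MvPolynomial.eval (e + t • (u + c • v)) f = 0 := by
      intro t
      rw [he, add_assoc, ← add_smul, ← eval_lineRestr, hc, eval_zero]
    have h2 : ∀ t : F, MvPolynomial.eval (e + t • v) f = 0 := by
      intro t
      rw [he', add_assoc, ← add_smul, ← eval_lineRestr, ha₁, eval_zero]
    have hzero : ∀ w, (∀ t : F, MvPolynomial.eval (e + t • w) f = 0) → dirDeriv f e w = 0 := by
      intro w hw
      have : lineRestr f e w = 0 := by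
        refine eq_zero_of_natDegree_lt_card_of_eval_eq_zero _ Function.injective_id (fun t => ?_)
          ((natDegree_lineRestr_le hf.totalDegree_le e w).trans_lt hs)
        rw [eval_lineRestr]
        exact hw _
      rw [← coeff_one_lineRestr, this, coeff_zero]
    have h3 : dirDeriv f e u = 0 := by
      have := hzero _ h1
      rwa [dirDeriv_add, dirDeriv_smul, hzero _ h2, mul_zero, add_zero] at this
    have he0 : MvPolynomial.eval e f = 0 := by simpa using h2 0
    have hee : e = x + (b + (a₁ - a) * c) • v + a₁ • u := by rw [he']; module
    have h4 := sum_zeroInd_line_lt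
      (lineRestr_ne_zero_of_dirDeriv hf (by rw [hee]; exact hd _ _)) he0 h3
    have h5 := natDegree_lineRestr_le_of_eval_eq_zero hf hu e
    have h6 := hcount (b + (a₁ - a) * c)
    rw [← Equiv.sum_comp (Equiv.addLeft a₁)] at h6
    simp only [Equiv.coe_addLeft, add_smul, ← add_assoc] at h6
    simp only [hee, add_smul, ← add_assoc] at h4 h5
    omega
  have h1 : ∑ b : F, ∑ t : F, zeroInd f (x + b • v + t • u) = Fintype.card F * s := by
    simp [hcount]
  rw [Finset.sum_comm, sum_plane_eq_pencil (fun t b => zeroInd f (x + b • v + t • u)) a b] at h1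
  have h2 : ∑ y : F, zeroInd f (x + y • v + a • u) ≤ s - 1 := by
    simp only [add_right_comm x _ (a • u)]
    exact (sum_zeroInd_line_le hne).trans
      (natDegree_lineRestr_le_of_dirDeriv_eq_zero hf hv (hdv _))
  have h3 : ∑ c : F, ∑ t ∈ Finset.univ.erase (0 : F),
      zeroInd f (x + (b + t * c) • v + (a + t) • u) ≤ Fintype.card F * (s - 1) := by
    rw [← smul_eq_mul, ← Finset.card_univ, ← Finset.sum_const]
    refine Finset.sum_le_sum fun c _ => ?_
    have h := sum_zeroInd_line_punctured_lt (hline c) hab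
    have h' := natDegree_lineRestr_le_of_eval_eq_zero hf (huv c) (x + a • u + b • v)
    refine Nat.le_pred_of_lt (lt_of_lt_of_le (lt_of_eq_of_lt ?_ h) h')
    refine Finset.sum_congr rfl fun t _ => congrArg _ ?_
    module
  obtain ⟨r, rfl⟩ : ∃ r, s = r + 1 := ⟨s - 1, by omega⟩
  simp only [Nat.add_sub_cancel] at h2 h3
  rw [mul_add] at h1
  omega

theorem eval_add_smul_eq_of_plane (hf : f.IsHomogeneous (s + 1)) (hs0 : 0 < s)
    (hs : s + 1 < Fintype.card F)
    (hv : MvPolynomial.eval v f = 0) (hdv : ∀ y, dirDeriv f v y = 0)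
    (huv : ∀ c : F, MvPolynomial.eval (u + c • v) f = 0)
    (hd : ∀ a b : F, dirDeriv f u (x + b • v + a • u) = dirDeriv f u x)
    (hd0 : dirDeriv f u x ≠ 0)
    (hcount : ∀ b : F, ∑ t : F, zeroInd f (x + b • v + t • u) = s) (b : F) :
    MvPolynomial.eval (x + b • v) f = MvPolynomial.eval x f := by
  classical
  have hu : MvPolynomial.eval u f = 0 := by simpa using huv 0
  obtain ⟨a₁, ha₁⟩ := exists_line_of_zeros hf hs0 hv hdv hcount
  have hfull : ∀ a : F, MvPolynomial.eval (x + a • u) f = 0 →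
      MvPolynomial.eval (x + b • v + a • u) f = 0 := by
    intro a ha
    have := lineRestr_eq_zero_of_line_of_zeros hf hs0 hs hv hdv huv
      (fun a b => by rwa [hd]) hcount ha₁ (a := a) (b := 0) (by simpa using ha)
    rw [add_right_comm, ← eval_lineRestr, this, eval_zero]
  have hdiff : lineRestr f (x + b • v) u - lineRestr f x u = 0 := by
    refine eq_zero_of_natDegree_lt_card_of_eval_eq_zero' _
      (Finset.univ.filter fun t : F => MvPolynomial.eval (x + t • u) f = 0) (fun t ht => ?_) ?_
    · have ht' := (Finset.mem_filter.1 ht).2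
      rw [eval_sub, eval_lineRestr, eval_lineRestr, ht', hfull t ht', sub_zero]
    · have hc := hcount 0
      simp only [zero_smul, add_zero, zeroInd] at hc
      rw [Finset.card_filter, hc]
      refine lt_of_le_of_lt (natDegree_le_pred (n := s) ?_ ?_) (Nat.sub_lt hs0 one_pos)
      · exact (natDegree_sub_le _ _).trans (max_le
          (natDegree_lineRestr_le_of_eval_eq_zero hf hu _)
          (natDegree_lineRestr_le_of_eval_eq_zero hf hu _))
      · have := hd 0 b
        rw [zero_smul, add_zero] at this
        rw [coeff_sub, coeff_lineRestr_pred hf, coeff_lineRestr_pred hf, this, sub_self]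
  have := congrArg (Polynomial.eval 0) hdiff
  simpa [eval_lineRestr, sub_eq_zero] using this

end Plane

/-- In the extremal case, translation along a singular point preserves the values of `f`. -/
theorem eval_add_smul_eq_of_isSingPt [Fintype L] (hf : f.IsHomogeneous (s + 1)) (hs0 : 0 < s)
    (hs : s + 1 < Fintype.card F) (hL : SubInX f L)
    (hmax : ∀ x ∉ L, ∃ z ∈ L, MvPolynomial.eval (x + z) f ≠ 0)
    (hZ : Fintype.card F * ∑ x, zeroInd f x + Fintype.card L * s =
      Fintype.card F * Fintype.card L + Fintype.card (Fin m → F) * s)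
    {v : Fin m → F} (hv : IsSingPt f v) (x : Fin m → F) (b : F) :
    MvPolynomial.eval (x + b • v) f = MvPolynomial.eval x f := by
  have hv' : ∀ u, dirDeriv f v u = 0 := fun u => by simp [dirDeriv, hv.2.2]
  have hvL := mem_of_isSingPt hf hs0 hs hL hmax hZ hv.2.1 hv'
  by_cases hx : x ∈ L
  · rw [hL _ hx, hL _ (L.add_mem hx (L.smul_mem _ hvL))]
  · obtain ⟨u, hu, hd, hcount⟩ := exists_dirDeriv_ne_zero hf hs0 hs hL hmax hZ hx
    refine eval_add_smul_eq_of_plane hf hs0 hs hv.2.1 hv'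
      (fun c => hL _ (L.add_mem hu (L.smul_mem _ hvL))) (fun a c => ?_) hd
      (fun c => hcount _ (L.smul_mem _ hvL)) b
    rw [add_assoc, dirDeriv_add_of_subInX hf hs hL hu
      (L.add_mem (L.smul_mem _ hvL) (L.smul_mem _ hu))]

end Subspace

section Global

variable {F : Type*} [Field F] {m s : ℕ} {f : MvPolynomial (Fin m) F}

theorem eval_smul_eq_zero_iff (hf : f.IsHomogeneous s) {c : F} (hc : c ≠ 0) (x : Fin m → F) :
    MvPolynomial.eval (c • x) f = 0 ↔ MvPolynomial.eval x f = 0 := by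
  simp [eval_smul_of_isHomogeneous hf, hc]

open Projectivization in
theorem card_nonzero_zeros_s7 [Fintype F] (hf : f.IsHomogeneous s) :
    Nat.card {x : Fin m → F // x ≠ 0 ∧ MvPolynomial.eval x f = 0} =
      (Fintype.card F - 1) * numPoints f := by
  classical
  rw [mul_comm, ← Fintype.card_units, ← Nat.card_eq_fintype_card, numPoints, ← Nat.card_prod]
  symm
  refine Nat.card_eq_of_bijective
    (fun pc : {p : Projectivization F (Fin m → F) // MvPolynomial.eval p.rep f = 0} × Fˣ =>
      (⟨(pc.2 : F) • pc.1.1.rep, smul_ne_zero pc.2.ne_zero (rep_nonzero _),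
        (eval_smul_eq_zero_iff hf pc.2.ne_zero _).2 pc.1.2⟩ :
        {x : Fin m → F // x ≠ 0 ∧ MvPolynomial.eval x f = 0})) ⟨?_, ?_⟩
  · rintro ⟨⟨p, hp⟩, c⟩ ⟨⟨p', hp'⟩, c'⟩ h
    have h' : (c : F) • p.rep = (c' : F) • p'.rep := congrArg Subtype.val h
    have hpp : p = p' := by
      rw [← mk_rep p, ← mk_rep p', mk_eq_mk_iff]
      refine ⟨c⁻¹ * c', ?_⟩
      rw [mul_smul, Units.smul_def c', ← h', ← Units.smul_def c, inv_smul_smul]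
    subst hpp
    have hc : c = c' := Units.ext (smul_left_injective F (rep_nonzero p) h')
    rw [hc]
  · rintro ⟨x, hx0, hx⟩
    obtain ⟨a, ha⟩ := exists_smul_eq_mk_rep F x hx0
    refine ⟨⟨⟨Projectivization.mk F x hx0, ?_⟩, a⁻¹⟩, ?_⟩
    · rw [← ha, Units.smul_def, eval_smul_eq_zero_iff hf a.ne_zero, hx]
    · simp only [← ha, ← Units.smul_def, inv_smul_smul]

theorem sum_zeroInd_eq [Fintype F] (hf : f.IsHomogeneous (s + 1)) :
    ∑ x, zeroInd f x = (Fintype.card F - 1) * numPoints f + 1 := by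
  classical
  have h0 : MvPolynomial.eval (0 : Fin m → F) f = 0 := by
    simpa using eval_smul_of_isHomogeneous hf 0 0
  rw [← card_nonzero_zeros_s7 hf, Nat.card_eq_fintype_card, Fintype.card_subtype,
    ← Finset.add_sum_erase _ _ (Finset.mem_univ 0), zeroInd_of_eq h0, add_comm]
  congr 1
  rw [Finset.card_filter, ← Finset.add_sum_erase _ _ (Finset.mem_univ 0)]
  rw [if_neg (by simp), zero_add]
  refine Finset.sum_congr rfl fun x hx => ?_
  have hx0 : x ≠ 0 := Finset.ne_of_mem_erase hx
  by_cases h : MvPolynomial.eval x f = 0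
  · rw [zeroInd_of_eq h, if_pos ⟨hx0, h⟩]
  · rw [zeroInd_of_ne h, if_neg fun h' => h h'.2]

theorem pred_mul_NP_add_one {q : ℕ} (hq : 1 ≤ q) (N : ℕ) :
    (q - 1) * NP q N + 1 = q ^ (N + 1) := by
  obtain ⟨r, rfl⟩ : ∃ r, q = r + 1 := ⟨q - 1, by omega⟩
  rw [← geom_sum_mul_add r (N + 1), NP, Nat.add_sub_cancel, mul_comm]

theorem exists_eval_ne_zero_of_maximal [Fintype F] (hf : f.IsHomogeneous (s + 1))
    {L : Submodule F (Fin m → F)} (hL : SubInX f L)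
    (hmax : ¬ ∃ W : Submodule F (Fin m → F),
      Module.finrank F W = Module.finrank F L + 1 ∧ SubInX f W)
    {x : Fin m → F} (hx : x ∉ L) : ∃ z ∈ L, MvPolynomial.eval (x + z) f ≠ 0 := by
  by_contra! h
  refine hmax ⟨L ⊔ Submodule.span F {x}, ?_, fun w hw => ?_⟩
  · rw [Submodule.finrank_sup_span_singleton hx]
  · obtain ⟨y, hy, z, hz, rfl⟩ := Submodule.mem_sup.1 hw
    obtain ⟨c, rfl⟩ := Submodule.mem_span_singleton.1 hz
    by_cases hc : c = 0
    · rw [hc, zero_smul, add_zero]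
      exact hL y hy
    · have : y + c • x = c • (x + c⁻¹ • y) := by
        rw [smul_add, smul_inv_smul₀ hc, add_comm]
      rw [this, eval_smul_eq_zero_iff hf hc]
      exact h _ (L.smul_mem _ hy)

open MvPolynomial in
/-- If `f` has degree less than `q`, translation invariance on points is an identity of
polynomials. -/
theorem aeval_translate_eq_rename [Fintype F] (hf : f.IsHomogeneous s)
    (hs : s < Fintype.card F) {v : Fin m → F}
    (h : ∀ (x : Fin m → F) (b : F), eval (x + b • v) f = eval x f) :
    aeval (fun i : Fin m => (X i.castSucc : MvPolynomial (Fin (m + 1)) F)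
      + C (v i) * X (Fin.last m)) f = rename Fin.castSucc f := by
  rw [← sub_eq_zero]
  set P := aeval (fun i : Fin m => (X i.castSucc : MvPolynomial (Fin (m + 1)) F)
      + C (v i) * X (Fin.last m)) f - rename Fin.castSucc f with hP
  have hhom : P.IsHomogeneous s := by
    refine IsHomogeneous.sub ?_ hf.rename_isHomogeneous
    have := hf.aeval (fun i : Fin m => (X i.castSucc : MvPolynomial (Fin (m + 1)) F)
      + C (v i) * X (Fin.last m)) (n := 1) fun i =>
        (isHomogeneous_X _ _).add
          (by simpa using (isHomogeneous_C _ (v i)).mul (isHomogeneous_X F _))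
    rwa [one_mul] at this
  refine eq_zero_of_eval_zero_at_prod_finset P (fun _ => Finset.univ) (fun i => ?_) fun x _ => ?_
  · exact ((degreeOf_le_totalDegree P i).trans hhom.totalDegree_le).trans_lt
      (by rwa [Finset.card_univ])
  · have key : eval x (aeval (fun i : Fin m => (X i.castSucc : MvPolynomial (Fin (m + 1)) F)
        + C (v i) * X (Fin.last m)) f) =
        eval ((x ∘ Fin.castSucc) + x (Fin.last m) • v) f := by
      rw [← coe_aeval_eq_eval, ← coe_aeval_eq_eval, RingHom.coe_coe, RingHom.coe_coe,
        comp_aeval_apply]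
      congr 2
      funext i
      simp [mul_comm]
    rw [hP, map_sub, key, eval_rename, h, sub_self]

end Global

theorem stmt7 {F : Type*} [Field F] [Fintype F] {n d k s : ℕ}
    (hq : Fintype.card F = s ^ 2) (hds : d = s + 1)
    (hn : 1 ≤ n) (hd : 2 ≤ d) (hk1 : 0 < k) (hkn : k ≤ n)
    (f : MvPolynomial (Fin (n + 2)) F) (hf0 : f ≠ 0) (hsq : Squarefree f)
    (hhom : f.IsHomogeneous d) (hthas : ThasEq f k)
    (heq : numPoints f = Theta (Fintype.card F) d n k) :
    ∀ v : Fin (n + 2) → F, IsSingPt f v →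
      MvPolynomial.aeval
          (fun i : Fin (n + 2) =>
            (MvPolynomial.X i.castSucc : MvPolynomial (Fin (n + 2 + 1)) F)
              + MvPolynomial.C (v i) * MvPolynomial.X (Fin.last (n + 2))) f
        = MvPolynomial.rename Fin.castSucc f := by
  classical
  intro v hv
  subst hds
  obtain ⟨⟨L, hLk, hL⟩, hmax⟩ := hthas
  have hq1 : 1 < Fintype.card F := Fintype.one_lt_card
  have hs1 : 2 ≤ s := by
    by_contra! h
    have : s = 1 := by omega
    rw [hq, this] at hq1
    omega
  have hs : s + 1 < Fintype.card F := by rw [hq]; nlinarith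
  have hLcard : Fintype.card L = Fintype.card F ^ (k + 1) := by
    rw [Module.card_eq_pow_finrank (K := F), hLk]
  refine aeval_translate_eq_rename hhom hs fun x b => eval_add_smul_eq_of_isSingPt hhom
    (by omega) hs hL (fun x hx => exists_eval_ne_zero_of_maximal hhom hL (by rwa [hLk]) hx)
    ?_ hv x b
  rw [sum_zeroInd_eq hhom, heq, hLcard, Theta, Nat.add_sub_cancel, Fintype.card_fun,
    Fintype.card_fin]
  have h1 := pred_mul_NP_add_one hq1.le (n - k)
  have h2 := pred_mul_NP_add_one hq1.le k
  obtain ⟨j, rfl⟩ : ∃ j, n = k + j := ⟨n - k, by omega⟩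
  rw [Nat.add_sub_cancel_left] at h1 ⊢
  generalize Fintype.card F = q at *
  have h3 : (q - 1) * (s * q ^ k * NP q j + NP q k) + 1 + s * q ^ k =
      s * q ^ k * q ^ (j + 1) + q ^ (k + 1) := by
    rw [← h1, ← h2]
    ring
  calc _ = q * ((q - 1) * (s * q ^ k * NP q j + NP q k) + 1 + s * q ^ k) := by ring
    _ = _ := by rw [h3]; ring
end
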